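/- Let Ω ⊂ ℝ be an open bounded interval, let f satisfy hypothesis (F), and let K > 0, T > 0. Then there exists Γ₄(K,T) > 0 such that whenever the data satisfy hypothesis (I) together with ‖u_{0t}‖_{L²(Ω)} + ‖u₀‖_{W^{1,2}(Ω)} + ‖Θ₀‖_{L²(Ω)} ≤ K, and (u,Θ) is a weak solution of system (P) on Ω×(0,T) belonging to the regularity class (R_T), one has sup_{t∈(0,T)} {‖u_t(·,t)‖_{L²(Ω)} + ‖Θ(·,t)‖_{L¹(Ω)}} + ∫₀^T∫_Ω Θ_x² ≤ Γ₄(K,T). -/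

import Mathlib

open MeasureTheory Filter Set Function

noncomputable section

/-- Integral over `Ω = (a,b)`. -/
def intOm (a b : ℝ) (g : ℝ → ℝ) : ℝ := ∫ x in Ioo a b, g x

/-- Double integral over `Ω × (0,T)`. -/
def intOmT (a b T : ℝ) (F : ℝ → ℝ → ℝ) : ℝ :=
  ∫ p in (Ioo a b) ×ˢ (Ioo 0 T), F p.1 p.2

/-- Squared `L²(Ω)` integral of `g`. -/
def sqOm (a b : ℝ) (g : ℝ → ℝ) : ℝ := ∫ x in Ioo a b, (g x) ^ 2

/-- `L²(Ω)` norm. -/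
def nrmL2 (a b : ℝ) (g : ℝ → ℝ) : ℝ := (∫ x in Ioo a b, (g x) ^ 2) ^ (1 / 2 : ℝ)

/-- `L¹(Ω)` norm. -/
def nrmL1 (a b : ℝ) (g : ℝ → ℝ) : ℝ := ∫ x in Ioo a b, |g x|

/-- Membership in `L²(Ω)`. -/
def MemL2 (a b : ℝ) (g : ℝ → ℝ) : Prop :=
  AEStronglyMeasurable g (volume.restrict (Ioo a b)) ∧
    IntegrableOn (fun x => (g x) ^ 2) (Ioo a b)

/-- Zero-trace weak derivative on `(a,b)`: `g ∈ W₀^{1,1}(a,b)` with weak derivative `g'`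
(integration by parts against all smooth test functions, with no boundary terms). -/
def WeakDerivZ (a b : ℝ) (g g' : ℝ → ℝ) : Prop :=
  ∀ ψ : ℝ → ℝ, ContDiff ℝ (⊤ : ℕ∞) ψ →
    ∫ x in Ioo a b, g x * deriv ψ x = - ∫ x in Ioo a b, g' x * ψ x

/-- Interior weak derivative on `(a,b)`: `g ∈ W^{1,1}(a,b)` with weak derivative `g'`. -/
def WeakDerivI (a b : ℝ) (g g' : ℝ → ℝ) : Prop :=
  ∀ ψ : ℝ → ℝ, ContDiff ℝ (⊤ : ℕ∞) ψ → tsupport ψ ⊆ Ioo a b →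
    ∫ x in Ioo a b, g x * deriv ψ x = - ∫ x in Ioo a b, g' x * ψ x

/-- Hypothesis (F) on the nonlinearity `f`, where `f'`, `f''` denote its first and second
derivatives on `[0,∞)`: `f ∈ C²([0,∞))`, `f(0)=0`, `f' > 0` on `[0,∞)`,
and `f' ∈ W^{1,∞}((0,∞))` (i.e. `f'` and `f''` are bounded). -/
structure HypF (f f' f'' : ℝ → ℝ) : Prop where
  hasDeriv₁ : ∀ x ∈ Ici (0 : ℝ), HasDerivWithinAt f (f' x) (Ici 0) x
  hasDeriv₂ : ∀ x ∈ Ici (0 : ℝ), HasDerivWithinAt f' (f'' x) (Ici 0) x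
  cont₂ : ContinuousOn f'' (Ici 0)
  zero : f 0 = 0
  pos : ∀ x ∈ Ici (0 : ℝ), 0 < f' x
  bdd : ∃ M : ℝ, ∀ x ∈ Ici (0 : ℝ), |f' x| ≤ M ∧ |f'' x| ≤ M

/-- Partial derivative in the first (spatial) variable. -/
def pdx (w : ℝ → ℝ → ℝ) : ℝ → ℝ → ℝ := fun x t => deriv (fun y => w y t) x

/-- Partial derivative in the second (time) variable. -/
def pdt (w : ℝ → ℝ → ℝ) : ℝ → ℝ → ℝ := fun x t => deriv (fun s => w x s) t

/-- Test functions in `C₀^∞(Ω × [0,T))`. -/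
structure TestU (a b T : ℝ) (φ : ℝ → ℝ → ℝ) : Prop where
  smooth : ContDiff ℝ (⊤ : ℕ∞) (uncurry φ)
  suppx : ∃ K : Set ℝ, IsCompact K ∧ K ⊆ Ioo a b ∧ ∀ x t, x ∉ K → φ x t = 0
  suppt : ∃ T' : ℝ, T' < T ∧ ∀ x t, T' ≤ t → φ x t = 0

/-- Test functions in `C^∞(Ω̄ × [0,T))`, compactly supported in time. -/
structure TestT (T : ℝ) (φ : ℝ → ℝ → ℝ) : Prop where
  smooth : ContDiff ℝ (⊤ : ℕ∞) (uncurry φ)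
  suppt : ∃ T' : ℝ, T' < T ∧ ∀ x t, T' ≤ t → φ x t = 0

/-- Test functions in `C₀^∞(Ω × (0,T))`. -/
structure TestInt (a b T : ℝ) (φ : ℝ → ℝ → ℝ) : Prop where
  smooth : ContDiff ℝ (⊤ : ℕ∞) (uncurry φ)
  suppx : ∃ K : Set ℝ, IsCompact K ∧ K ⊆ Ioo a b ∧ ∀ x t, x ∉ K → φ x t = 0
  supptime : ∃ K : Set ℝ, IsCompact K ∧ K ⊆ Ioo 0 T ∧ ∀ x t, t ∉ K → φ x t = 0

/-- Definition (W): weak solution of (P) on `Ω × (0,T)`.  Here `ut`, `ux`, `Θx` denote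
the weak derivatives of `u` (in time and space) and of `Θ` (in space). -/
structure IsWeakSol (a b T : ℝ) (f f' : ℝ → ℝ) (u0 u0t Θ0 : ℝ → ℝ)
    (u ut ux Θ Θx : ℝ → ℝ → ℝ) : Prop where
  u_sliceL1 : ∀ t ∈ Icc 0 T, IntegrableOn (fun x => u x t) (Ioo a b)
  u_contL1 : ∀ t₀ ∈ Icc 0 T,
    Tendsto (fun t => ∫ x in Ioo a b, |u x t - u x t₀|) (nhdsWithin t₀ (Icc 0 T)) (nhds 0)
  u_int : IntegrableOn (fun p : ℝ × ℝ => u p.1 p.2) ((Ioo a b) ×ˢ (Ioo 0 T))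
  ux_int : IntegrableOn (fun p : ℝ × ℝ => ux p.1 p.2) ((Ioo a b) ×ˢ (Ioo 0 T))
  u_W0 : ∀ᵐ t ∂volume.restrict (Ioo 0 T), WeakDerivZ a b (fun x => u x t) (fun x => ux x t)
  Θ_int : IntegrableOn (fun p : ℝ × ℝ => Θ p.1 p.2) ((Ioo a b) ×ˢ (Ioo 0 T))
  Θx_int : IntegrableOn (fun p : ℝ × ℝ => Θx p.1 p.2) ((Ioo a b) ×ˢ (Ioo 0 T))
  Θ_W : ∀ᵐ t ∂volume.restrict (Ioo 0 T), WeakDerivI a b (fun x => Θ x t) (fun x => Θx x t)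
  Θ_nonneg : ∀ᵐ p ∂volume.restrict ((Ioo a b) ×ˢ (Ioo 0 T)), 0 ≤ Θ p.1 p.2
  ut_weak : ∀ φ : ℝ → ℝ → ℝ, TestInt a b T φ →
    intOmT a b T (fun x t => u x t * pdt φ x t) = - intOmT a b T (fun x t => ut x t * φ x t)
  ut_int : IntegrableOn (fun p : ℝ × ℝ => ut p.1 p.2) ((Ioo a b) ×ˢ (Ioo 0 T))
  g1_int : IntegrableOn (fun p : ℝ × ℝ => f' (Θ p.1 p.2) * Θx p.1 p.2)
    ((Ioo a b) ×ˢ (Ioo 0 T))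
  g2_int : IntegrableOn (fun p : ℝ × ℝ => f' (Θ p.1 p.2) * Θx p.1 p.2 * ut p.1 p.2)
    ((Ioo a b) ×ˢ (Ioo 0 T))
  g3_int : IntegrableOn (fun p : ℝ × ℝ => f (Θ p.1 p.2) * ut p.1 p.2)
    ((Ioo a b) ×ˢ (Ioo 0 T))
  weak_u : ∀ φ : ℝ → ℝ → ℝ, TestU a b T φ →
    intOmT a b T (fun x t => u x t * pdt (pdt φ) x t)
        - intOm a b (fun x => u0t x * φ x 0) + intOm a b (fun x => u0 x * pdt φ x 0)
      = - intOmT a b T (fun x t => ux x t * pdx φ x t)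
        - intOmT a b T (fun x t => f' (Θ x t) * Θx x t * φ x t)
  weak_Θ : ∀ φ : ℝ → ℝ → ℝ, TestT T φ →
    - intOmT a b T (fun x t => Θ x t * pdt φ x t) - intOm a b (fun x => Θ0 x * φ x 0)
      = - intOmT a b T (fun x t => Θx x t * pdx φ x t)
        + intOmT a b T (fun x t => f' (Θ x t) * Θx x t * ut x t * φ x t)
        + intOmT a b T (fun x t => f (Θ x t) * ut x t * pdx φ x t)

/-- Continuity of `t ↦ w(·,t)` as a map `J → L²(Ω)` (with slices in `L²(Ω)`). -/
def ContL2 (a b : ℝ) (J : Set ℝ) (w : ℝ → ℝ → ℝ) : Prop :=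
  (∀ t ∈ J, MemL2 a b (fun x => w x t)) ∧
    ∀ t₀ ∈ J, Tendsto (fun t => ∫ x in Ioo a b, (w x t - w x t₀) ^ 2)
      (nhdsWithin t₀ J) (nhds 0)

/-- The regularity class (R_T):  `u ∈ C⁰([0,T];W₀^{1,2})`, `u_t ∈ C⁰([0,T];L²)`,
`Θ ∈ C⁰([0,T];L²) ∩ L²((0,T);W^{1,2})`. -/
structure RegT (a b T : ℝ) (u ut ux Θ Θx : ℝ → ℝ → ℝ) : Prop where
  u_cont : ContL2 a b (Icc 0 T) u
  ux_cont : ContL2 a b (Icc 0 T) ux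
  u_W0 : ∀ t ∈ Icc (0 : ℝ) T, WeakDerivZ a b (fun x => u x t) (fun x => ux x t)
  ut_cont : ContL2 a b (Icc 0 T) ut
  Θ_cont : ContL2 a b (Icc 0 T) Θ
  Θ_sq_int : IntegrableOn (fun p : ℝ × ℝ => (Θ p.1 p.2) ^ 2) ((Ioo a b) ×ˢ (Ioo 0 T))
  Θx_sq_int : IntegrableOn (fun p : ℝ × ℝ => (Θx p.1 p.2) ^ 2) ((Ioo a b) ×ˢ (Ioo 0 T))

/-- Data hypothesis (I), with `u0x` the weak derivative of `u0 ∈ W₀^{1,2}(Ω)`. -/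
structure DataI (a b : ℝ) (u0 u0x u0t Θ0 : ℝ → ℝ) : Prop where
  u0_L2 : MemL2 a b u0
  u0x_L2 : MemL2 a b u0x
  u0_W0 : WeakDerivZ a b u0 u0x
  u0t_L2 : MemL2 a b u0t
  Θ0_L2 : MemL2 a b Θ0
  Θ0_nonneg : ∀ᵐ x ∂volume.restrict (Ioo a b), 0 ≤ Θ0 x

/-- Smooth-data hypothesis (I∞). -/
structure SmoothData (a b : ℝ) (v0 u0 Θ0 : ℝ → ℝ) : Prop where
  v0_smooth : ContDiff ℝ (⊤ : ℕ∞) v0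
  v0_supp : ∃ K : Set ℝ, IsCompact K ∧ K ⊆ Ioo a b ∧ ∀ x, x ∉ K → v0 x = 0
  u0_smooth : ContDiff ℝ (⊤ : ℕ∞) u0
  u0_supp : ∃ K : Set ℝ, IsCompact K ∧ K ⊆ Ioo a b ∧ ∀ x, x ∉ K → u0 x = 0
  Θ0_smooth : ContDiff ℝ (⊤ : ℕ∞) Θ0
  Θ0_pos : ∀ x ∈ Icc a b, 0 < Θ0 x
  Θ0x_supp : ∃ K : Set ℝ, IsCompact K ∧ K ⊆ Ioo a b ∧ ∀ x, x ∉ K → deriv Θ0 x = 0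

/-- Classical solution of the regularized problem (P_ε), of class
`C^{4,1} × C^{2,1} × C^{2,1}(Ω̄ × [0,∞))`, with positive temperature. -/
structure IsClassicalSolEps (a b : ℝ) (f : ℝ → ℝ) (ε : ℝ) (v0 u0 Θ0 : ℝ → ℝ)
    (v u Θ : ℝ → ℝ → ℝ) : Prop where
  diffx_v : ∀ k < 4, ∀ x ∈ Icc a b, ∀ t ∈ Ici (0 : ℝ),
    DifferentiableAt ℝ (fun y => pdx^[k] v y t) x
  difft_v : ∀ x ∈ Icc a b, ∀ t ∈ Ici (0 : ℝ), DifferentiableAt ℝ (fun s => v x s) t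
  cont_v : ∀ k ≤ 4, ContinuousOn (uncurry (pdx^[k] v)) ((Icc a b) ×ˢ (Ici 0))
  contt_v : ContinuousOn (uncurry (pdt v)) ((Icc a b) ×ˢ (Ici 0))
  diffx_u : ∀ k < 2, ∀ x ∈ Icc a b, ∀ t ∈ Ici (0 : ℝ),
    DifferentiableAt ℝ (fun y => pdx^[k] u y t) x
  difft_u : ∀ x ∈ Icc a b, ∀ t ∈ Ici (0 : ℝ), DifferentiableAt ℝ (fun s => u x s) t
  cont_u : ∀ k ≤ 2, ContinuousOn (uncurry (pdx^[k] u)) ((Icc a b) ×ˢ (Ici 0))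
  contt_u : ContinuousOn (uncurry (pdt u)) ((Icc a b) ×ˢ (Ici 0))
  diffx_Θ : ∀ k < 2, ∀ x ∈ Icc a b, ∀ t ∈ Ici (0 : ℝ),
    DifferentiableAt ℝ (fun y => pdx^[k] Θ y t) x
  difft_Θ : ∀ x ∈ Icc a b, ∀ t ∈ Ici (0 : ℝ), DifferentiableAt ℝ (fun s => Θ x s) t
  cont_Θ : ∀ k ≤ 2, ContinuousOn (uncurry (pdx^[k] Θ)) ((Icc a b) ×ˢ (Ici 0))
  contt_Θ : ContinuousOn (uncurry (pdt Θ)) ((Icc a b) ×ˢ (Ici 0))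
  Θ_pos : ∀ x ∈ Icc a b, ∀ t ∈ Ici (0 : ℝ), 0 < Θ x t
  eq_v : ∀ x ∈ Ioo a b, ∀ t ∈ Ioi (0 : ℝ),
    pdt v x t = -ε * pdx^[4] v x t + pdx^[2] u x t - pdx (fun y s => f (Θ y s)) x t
  eq_u : ∀ x ∈ Ioo a b, ∀ t ∈ Ioi (0 : ℝ), pdt u x t = ε * pdx^[2] u x t + v x t
  eq_Θ : ∀ x ∈ Ioo a b, ∀ t ∈ Ioi (0 : ℝ),
    pdt Θ x t = pdx^[2] Θ x t - f (Θ x t) * pdx v x t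
  bc_v : ∀ t ∈ Ioi (0 : ℝ),
    v a t = 0 ∧ v b t = 0 ∧ pdx^[2] v a t = 0 ∧ pdx^[2] v b t = 0
  bc_u : ∀ t ∈ Ioi (0 : ℝ), u a t = 0 ∧ u b t = 0
  bc_Θ : ∀ t ∈ Ioi (0 : ℝ), pdx Θ a t = 0 ∧ pdx Θ b t = 0
  init : ∀ x ∈ Icc a b, v x 0 = v0 x ∧ u x 0 = u0 x ∧ Θ x 0 = Θ0 x

/-- Weak convergence in `L²_loc(Ω̄ × [0,∞))`. -/
def WkL2loc (a b : ℝ) (wj : ℕ → ℝ → ℝ → ℝ) (w : ℝ → ℝ → ℝ) : Prop :=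
  ∀ T > (0 : ℝ), ∀ ψ : ℝ → ℝ → ℝ,
    AEStronglyMeasurable (fun p : ℝ × ℝ => ψ p.1 p.2)
      (volume.restrict ((Icc a b) ×ˢ (Icc 0 T))) →
    IntegrableOn (fun p : ℝ × ℝ => (ψ p.1 p.2) ^ 2) ((Icc a b) ×ˢ (Icc 0 T)) →
    Tendsto (fun j => ∫ p in (Icc a b) ×ˢ (Icc 0 T), wj j p.1 p.2 * ψ p.1 p.2) atTop
      (nhds (∫ p in (Icc a b) ×ˢ (Icc 0 T), w p.1 p.2 * ψ p.1 p.2))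

/-- Smooth test functions of time that vanish near `T` and beyond. -/
structure TimeTest (T : ℝ) (χ : ℝ → ℝ) : Prop where
  smooth : ContDiff ℝ (⊤ : ℕ∞) χ
  supp : ∃ T' : ℝ, T' < T ∧ ∀ t, T' ≤ t → χ t = 0

/-- The primitive of `q` with value `c` at `0`. -/
def prim (c : ℝ) (q : ℝ → ℝ) (t : ℝ) : ℝ := c + ∫ s in (0 : ℝ)..t, q s

lemma prim_zero (c : ℝ) (q : ℝ → ℝ) : prim c q 0 = c := by simp [prim]

lemma integrableOn_Ioo_iff_intervalIntegrable {T : ℝ} (hT : 0 < T) {q : ℝ → ℝ} :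
    IntegrableOn q (Ioo 0 T) ↔ IntervalIntegrable q volume 0 T := by
  rw [intervalIntegrable_iff_integrableOn_Ioo_of_le hT.le]

lemma prim_absolutelyContinuous {T : ℝ} (hT : 0 < T) {q : ℝ → ℝ} (hq : IntegrableOn q (Ioo 0 T))
    (c : ℝ) : AbsolutelyContinuousOnInterval (prim c q) 0 T := by
  have h1 := ((integrableOn_Ioo_iff_intervalIntegrable hT).1
    hq).absolutelyContinuousOnInterval_intervalIntegral (c := 0) left_mem_uIcc
  have h2 : AbsolutelyContinuousOnInterval (fun _ : ℝ => c) 0 T :=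
    ContDiffOn.absolutelyContinuousOnInterval (by fun_prop)
  exact h2.add h1

lemma prim_continuousOn {T : ℝ} (hT : 0 < T) {q : ℝ → ℝ} (hq : IntegrableOn q (Ioo 0 T))
    (c : ℝ) : ContinuousOn (prim c q) (Icc 0 T) := by
  have := (prim_absolutelyContinuous hT hq c).continuousOn
  rwa [uIcc_of_le hT.le] at this

lemma deriv_prim_ae {T : ℝ} (hT : 0 < T) {q : ℝ → ℝ} (hq : IntegrableOn q (Ioo 0 T)) (c : ℝ) :
    ∀ᵐ t, t ∈ uIcc 0 T → deriv (prim c q) t = q t := by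
  filter_upwards [((integrableOn_Ioo_iff_intervalIntegrable hT).1 hq).ae_hasDerivAt_integral]
    with t ht htm
  exact ((ht htm 0 left_mem_uIcc).const_add c).deriv

lemma integral_Ioo_eq_interval {t : ℝ} (ht : 0 ≤ t) (g : ℝ → ℝ) :
    ∫ s in Ioo 0 t, g s = ∫ s in (0 : ℝ)..t, g s := by
  rw [intervalIntegral.integral_of_le ht, integral_Ioc_eq_integral_Ioo]

lemma prim_sq {T : ℝ} {q : ℝ → ℝ} (hq : IntegrableOn q (Ioo 0 T)) (c : ℝ)
    {t : ℝ} (ht0 : 0 < t) (htT : t ≤ T) :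
    prim c q t ^ 2 = c ^ 2 + 2 * ∫ s in Ioo 0 t, prim c q s * q s := by
  have hq' : IntegrableOn q (Ioo 0 t) := hq.mono_set (Ioo_subset_Ioo_right htT)
  have hac := prim_absolutelyContinuous ht0 hq' c
  have h := hac.integral_deriv_mul_eq_sub hac
  rw [prim_zero] at h
  have h2 : ∫ x in (0 : ℝ)..t, deriv (prim c q) x * prim c q x + prim c q x * deriv (prim c q) x
      = ∫ x in (0 : ℝ)..t, 2 * (prim c q x * q x) := by
    apply intervalIntegral.integral_congr_ae
    filter_upwards [deriv_prim_ae ht0 hq' c] with x hx hxm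
    rw [hx (uIoc_subset_uIcc hxm)]; ring
  rw [h2, intervalIntegral.integral_const_mul] at h
  rw [integral_Ioo_eq_interval ht0.le]
  linarith

lemma TimeTest.zero_at {T : ℝ} {χ : ℝ → ℝ} (h : TimeTest T χ) : χ T = 0 := by
  obtain ⟨T', h1, h2⟩ := h.supp
  exact h2 T h1.le

lemma TimeTest.differentiable {T : ℝ} {χ : ℝ → ℝ} (h : TimeTest T χ) : Differentiable ℝ χ :=
  h.smooth.differentiable (by simp)

lemma TimeTest.continuous {T : ℝ} {χ : ℝ → ℝ} (h : TimeTest T χ) : Continuous χ :=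
  h.smooth.continuous

lemma TimeTest.deriv {T : ℝ} {χ : ℝ → ℝ} (h : TimeTest T χ) : TimeTest T (deriv χ) := by
  refine ⟨?_, ?_⟩
  · have := h.smooth
    exact (contDiff_infty_iff_deriv.1 this).2
  · obtain ⟨T', h1, h2⟩ := h.supp
    refine ⟨(T' + T) / 2, by linarith, fun t ht => ?_⟩
    have : χ =ᶠ[nhds t] fun _ => 0 := by
      filter_upwards [lt_mem_nhds (show T' < t by linarith)] with s hs
      exact h2 s hs.le
    rw [this.deriv_eq]; simp

/-- Every test function of time is the derivative of another one. -/
lemma TimeTest.exists_primitive {T : ℝ} {η : ℝ → ℝ} (h : TimeTest T η) :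
    ∃ χ, TimeTest T χ ∧ _root_.deriv χ = η := by
  have hd : ∀ t, HasDerivAt (fun t => ∫ s in T..t, η s) (η t) t := fun t =>
    intervalIntegral.integral_hasDerivAt_right (h.continuous.intervalIntegrable _ _)
      (h.continuous.stronglyMeasurableAtFilter _ _) h.continuous.continuousAt
  have hde : _root_.deriv (fun t => ∫ s in T..t, η s) = η := funext fun t => (hd t).deriv
  refine ⟨fun t => ∫ s in T..t, η s, ⟨?_, ?_⟩, hde⟩
  · refine contDiff_infty_iff_deriv.2 ⟨fun t => (hd t).differentiableAt, ?_⟩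
    rw [hde]; exact h.smooth
  · obtain ⟨T', h1, h2⟩ := h.supp
    refine ⟨T', h1, fun t ht => ?_⟩
    rw [intervalIntegral.integral_congr (g := fun _ => (0 : ℝ))]
    · simp
    · intro s hs
      apply h2
      rcases le_total T t with h3 | h3
      · rw [uIcc_of_le h3] at hs; linarith [hs.1]
      · rw [uIcc_of_ge h3] at hs; linarith [hs.1]

lemma timeTest_of_tsupport {T : ℝ} (hT : 0 < T) {η : ℝ → ℝ} (h1 : ContDiff ℝ (⊤ : ℕ∞) η)
    (h2 : HasCompactSupport η) (h3 : tsupport η ⊆ Ioo 0 T) : TimeTest T η := by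
  refine ⟨h1, ?_⟩
  rcases (tsupport η).eq_empty_or_nonempty with h | h
  · refine ⟨0, hT, fun t _ => ?_⟩
    exact image_eq_zero_of_notMem_tsupport (by simp [h])
  · have hm := IsCompact.sSup_mem h2 h
    refine ⟨(sSup (tsupport η) + T) / 2, by linarith [(h3 hm).2], fun t ht => ?_⟩
    apply image_eq_zero_of_notMem_tsupport
    intro htm
    have := le_csSup h2.bddAbove htm
    linarith [(h3 hm).2]

lemma integral_prim_mul_deriv {T : ℝ} (hT : 0 < T) {q : ℝ → ℝ} (hq : IntegrableOn q (Ioo 0 T))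
    (c : ℝ) {χ : ℝ → ℝ} (hχ : TimeTest T χ) :
    ∫ t in Ioo 0 T, prim c q t * deriv χ t = - c * χ 0 - ∫ t in Ioo 0 T, q t * χ t := by
  have hac := prim_absolutelyContinuous hT hq c
  have hχc : AbsolutelyContinuousOnInterval χ 0 T :=
    ContDiffOn.absolutelyContinuousOnInterval (hχ.smooth.of_le (by norm_cast)).contDiffOn
  have h := hac.integral_mul_deriv_eq_deriv_mul hχc
  rw [prim_zero, hχ.zero_at] at h
  rw [integral_Ioo_eq_interval hT.le, integral_Ioo_eq_interval hT.le, h]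
  have h2 : ∫ x in (0 : ℝ)..T, deriv (prim c q) x * χ x = ∫ x in (0 : ℝ)..T, q x * χ x := by
    apply intervalIntegral.integral_congr_ae
    filter_upwards [deriv_prim_ae hT hq c] with x hx hxm
    rw [hx (uIoc_subset_uIcc hxm)]
  rw [h2]; ring

lemma Integrable.mul_of_continuousOn {T : ℝ} {q χ : ℝ → ℝ} (hq : IntegrableOn q (Ioo 0 T))
    (hχ : ContinuousOn χ (Icc 0 T)) : IntegrableOn (fun t => q t * χ t) (Ioo 0 T) := by
  rw [← integrableOn_Icc_iff_integrableOn_Ioo] at hq ⊢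
  exact hq.mul_continuousOn hχ isCompact_Icc

lemma ContinuousOn.integrableOn_Ioo {T : ℝ} {q : ℝ → ℝ} (hq : ContinuousOn q (Icc 0 T)) :
    IntegrableOn q (Ioo 0 T) :=
  (hq.integrableOn_compact isCompact_Icc).mono_set Ioo_subset_Icc_self

lemma ae_eq_of_integral_test {T : ℝ} {p r : ℝ → ℝ} (hp : IntegrableOn p (Ioo 0 T))
    (hr : IntegrableOn r (Ioo 0 T))
    (h : ∀ η : ℝ → ℝ, ContDiff ℝ (⊤ : ℕ∞) η → HasCompactSupport η → tsupport η ⊆ Ioo 0 T →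
      ∫ t in Ioo 0 T, p t * η t = ∫ t in Ioo 0 T, r t * η t) :
    p =ᵐ[volume.restrict (Ioo 0 T)] r := by
  have h1 : ∀ᵐ t, t ∈ Ioo 0 T → (p - r) t = 0 := by
    refine isOpen_Ioo.ae_eq_zero_of_integral_contDiff_smul_eq_zero
      (hp.sub hr).locallyIntegrableOn ?_
    intro η h1 h2 h3
    have h4 : ∫ t, η t • (p - r) t = ∫ t in Ioo 0 T, η t • (p - r) t := by
      rw [setIntegral_eq_integral_of_forall_compl_eq_zero]
      intro t ht
      rw [image_eq_zero_of_notMem_tsupport (fun h => ht (h3 h)), zero_smul]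
    rw [h4]
    have h5 : ∀ t, η t • (p - r) t = p t * η t - r t * η t := by
      intro t; simp; ring
    simp_rw [h5]
    rw [integral_sub (Integrable.mul_of_continuousOn hp h1.continuous.continuousOn)
      (Integrable.mul_of_continuousOn hr h1.continuous.continuousOn), h η h1 h2 h3, sub_self]
  rw [EventuallyEq, ae_restrict_iff' measurableSet_Ioo]
  filter_upwards [h1] with t ht htm
  have := ht htm
  simpa [sub_eq_zero] using this

lemma ae_eq_prim_of_weak {T : ℝ} (hT : 0 < T) {p q : ℝ → ℝ} {c : ℝ}
    (hp : IntegrableOn p (Ioo 0 T)) (hq : IntegrableOn q (Ioo 0 T))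
    (h : ∀ χ, TimeTest T χ →
      - (∫ t in Ioo 0 T, p t * deriv χ t) - c * χ 0 = ∫ t in Ioo 0 T, q t * χ t) :
    p =ᵐ[volume.restrict (Ioo 0 T)] prim c q := by
  refine ae_eq_of_integral_test hp (prim_continuousOn hT hq c).integrableOn_Ioo ?_
  intro η h1 h2 h3
  obtain ⟨χ, hχ, rfl⟩ := (timeTest_of_tsupport hT h1 h2 h3).exists_primitive
  rw [integral_prim_mul_deriv hT hq c hχ, ← h χ hχ]
  ring

lemma ae_eq_prim_prim_of_weak {T : ℝ} (hT : 0 < T) {p q : ℝ → ℝ} {c d : ℝ}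
    (hp : IntegrableOn p (Ioo 0 T)) (hq : IntegrableOn q (Ioo 0 T))
    (h : ∀ χ, TimeTest T χ →
      (∫ t in Ioo 0 T, p t * deriv (deriv χ) t) - d * χ 0 + c * deriv χ 0
        = ∫ t in Ioo 0 T, q t * χ t) :
    p =ᵐ[volume.restrict (Ioo 0 T)] prim c (prim d q) := by
  refine ae_eq_prim_of_weak hT hp (prim_continuousOn hT hq d).integrableOn_Ioo ?_
  intro η hη
  obtain ⟨χ, hχ, rfl⟩ := hη.exists_primitive
  rw [integral_prim_mul_deriv hT hq d hχ]
  have := h χ hχ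
  linarith

lemma eqOn_Icc_of_ae_eq_Ioo {T : ℝ} (hT : 0 < T) {p r : ℝ → ℝ}
    (hp : ContinuousOn p (Icc 0 T)) (hr : ContinuousOn r (Icc 0 T))
    (h : p =ᵐ[volume.restrict (Ioo 0 T)] r) : EqOn p r (Icc 0 T) := by
  refine Measure.eqOn_Icc_of_ae_eq volume hT.ne ?_ hp hr
  rwa [restrict_Ioo_eq_restrict_Icc] at h

/-- The wave number `n π / (b - a)`. -/
def kap (a b : ℝ) (n : ℕ) : ℝ := n * Real.pi / (b - a)

/-- The uniform bound `√(2 / (b - a))` of the normalized modes. -/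
def bet (a b : ℝ) : ℝ := √(2 / (b - a))

/-- Normalized Dirichlet modes on `(a,b)`. -/
def es (a b : ℝ) (n : ℕ) (x : ℝ) : ℝ := bet a b * Real.sin (kap a b (n + 1) * (x - a))

/-- Normalized Neumann modes on `(a,b)`. -/
def ec (a b : ℝ) (n : ℕ) (x : ℝ) : ℝ :=
  (if n = 0 then √(1 / (b - a)) else bet a b) * Real.cos (kap a b n * (x - a))

lemma bet_nonneg (a b : ℝ) : 0 ≤ bet a b := Real.sqrt_nonneg _

lemma kap_pos {a b : ℝ} (hab : a < b) (n : ℕ) : 0 < kap a b (n + 1) := by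
  have : 0 < b - a := sub_pos.2 hab
  unfold kap; positivity

lemma abs_es_le (a b : ℝ) (n : ℕ) (x : ℝ) : |es a b n x| ≤ bet a b := by
  rw [es, abs_mul, abs_of_nonneg (bet_nonneg a b)]
  exact mul_le_of_le_one_right (bet_nonneg a b) (Real.abs_sin_le_one _)

lemma abs_ec_le {a b : ℝ} (hab : a < b) (n : ℕ) (x : ℝ) : |ec a b n x| ≤ bet a b := by
  have hL : 0 < b - a := sub_pos.2 hab
  rw [ec, abs_mul]
  have h1 : |if n = 0 then √(1 / (b - a)) else bet a b| ≤ bet a b := by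
    split_ifs
    · rw [abs_of_nonneg (Real.sqrt_nonneg _)]
      apply Real.sqrt_le_sqrt; gcongr; norm_num
    · rw [abs_of_nonneg (bet_nonneg a b)]
  calc _ ≤ bet a b * 1 := mul_le_mul h1 (Real.abs_cos_le_one _) (abs_nonneg _) (bet_nonneg a b)
    _ = _ := mul_one _

lemma contDiff_es (a b : ℝ) (n : ℕ) : ContDiff ℝ (⊤ : ℕ∞) (es a b n) := by
  unfold es; fun_prop

lemma contDiff_ec (a b : ℝ) (n : ℕ) : ContDiff ℝ (⊤ : ℕ∞) (ec a b n) := by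
  unfold ec; fun_prop

lemma continuous_es (a b : ℝ) (n : ℕ) : Continuous (es a b n) := (contDiff_es a b n).continuous

lemma continuous_ec (a b : ℝ) (n : ℕ) : Continuous (ec a b n) := (contDiff_ec a b n).continuous

lemma hasDerivAt_es (a b : ℝ) (n : ℕ) (x : ℝ) :
    HasDerivAt (es a b n) (kap a b (n + 1) * ec a b (n + 1) x) x := by
  have h : HasDerivAt (fun x : ℝ => kap a b (n + 1) * (x - a)) (kap a b (n + 1) * 1) x :=
    ((hasDerivAt_id x).sub_const a).const_mul _
  exact ((h.sin).const_mul (bet a b)).congr_deriv (by simp [ec]; ring)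

lemma hasDerivAt_ec (a b : ℝ) (n : ℕ) (x : ℝ) :
    HasDerivAt (ec a b (n + 1)) (-(kap a b (n + 1) * es a b n x)) x := by
  have h : HasDerivAt (fun x : ℝ => kap a b (n + 1) * (x - a)) (kap a b (n + 1) * 1) x :=
    ((hasDerivAt_id x).sub_const a).const_mul _
  have h3 : ec a b (n + 1) = fun x => bet a b * Real.cos (kap a b (n + 1) * (x - a)) := by
    funext y; simp [ec]
  rw [h3]
  exact ((h.cos).const_mul (bet a b)).congr_deriv (by simp [es]; ring)

lemma deriv_es (a b : ℝ) (n : ℕ) : deriv (es a b n) = fun x => kap a b (n + 1) * ec a b (n + 1) x :=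
  funext fun x => (hasDerivAt_es a b n x).deriv

lemma deriv_ec (a b : ℝ) (n : ℕ) :
    deriv (ec a b (n + 1)) = fun x => -(kap a b (n + 1) * es a b n x) :=
  funext fun x => (hasDerivAt_ec a b n x).deriv

lemma es_left (a b : ℝ) (n : ℕ) : es a b n a = 0 := by simp [es]

lemma es_right {a b : ℝ} (hab : a < b) (n : ℕ) : es a b n b = 0 := by
  have hL : b - a ≠ 0 := (sub_pos.2 hab).ne'
  have : kap a b (n + 1) * (b - a) = ((n + 1 : ℕ) : ℝ) * Real.pi := by
    unfold kap; field_simp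
  rw [es, this, Real.sin_nat_mul_pi, mul_zero]

lemma integral_cos_mode {a b : ℝ} (hab : a < b) (j : ℤ) :
    ∫ x in Ioo a b, Real.cos (j * Real.pi / (b - a) * (x - a)) = if j = 0 then b - a else 0 := by
  have hL : 0 < b - a := sub_pos.2 hab
  rw [← integral_Ioc_eq_integral_Ioo, ← intervalIntegral.integral_of_le hab.le]
  split_ifs with hj
  · simp [hj]
  · have hk : (j : ℝ) * Real.pi / (b - a) ≠ 0 := by
      have : (j : ℝ) ≠ 0 := by exact_mod_cast hj
      have := Real.pi_ne_zero
      positivity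
    have h := intervalIntegral.integral_comp_mul_sub (f := Real.cos) (a := a) (b := b) hk
      ((j : ℝ) * Real.pi / (b - a) * a)
    have h2 : ∀ x : ℝ, (j : ℝ) * Real.pi / (b - a) * (x - a)
      = (j : ℝ) * Real.pi / (b - a) * x - (j : ℝ) * Real.pi / (b - a) * a := fun x => by ring
    simp_rw [h2, h, integral_cos]
    have h3 : (j : ℝ) * Real.pi / (b - a) * b - (j : ℝ) * Real.pi / (b - a) * a = j * Real.pi := by
      field_simp
    rw [h3, Real.sin_int_mul_pi]; simp

lemma integrableOn_of_continuous {a b : ℝ} {g : ℝ → ℝ} (hg : Continuous g) :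
    IntegrableOn g (Ioo a b) :=
  (hg.continuousOn.integrableOn_compact isCompact_Icc).mono_set Ioo_subset_Icc_self

lemma integral_cos_mul_cos {a b : ℝ} (hab : a < b) (m n : ℕ) :
    ∫ x in Ioo a b, Real.cos (kap a b m * (x - a)) * Real.cos (kap a b n * (x - a))
      = ((if (m : ℤ) - n = 0 then b - a else 0) + (if (m : ℤ) + n = 0 then b - a else 0)) / 2 := by
  rw [← integral_cos_mode hab, ← integral_cos_mode hab, ← integral_add
    (integrableOn_of_continuous (by fun_prop)) (integrableOn_of_continuous (by fun_prop)),
    ← integral_div]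
  congr 1; funext x
  have h1 : (((m : ℤ) - n : ℤ) : ℝ) * Real.pi / (b - a) * (x - a)
    = kap a b m * (x - a) - kap a b n * (x - a) := by unfold kap; push_cast; ring
  have h2 : (((m : ℤ) + n : ℤ) : ℝ) * Real.pi / (b - a) * (x - a)
    = kap a b m * (x - a) + kap a b n * (x - a) := by unfold kap; push_cast; ring
  rw [h1, h2, Real.cos_sub, Real.cos_add]; ring

lemma integral_sin_mul_sin {a b : ℝ} (hab : a < b) (m n : ℕ) :
    ∫ x in Ioo a b, Real.sin (kap a b m * (x - a)) * Real.sin (kap a b n * (x - a))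
      = ((if (m : ℤ) - n = 0 then b - a else 0) - (if (m : ℤ) + n = 0 then b - a else 0)) / 2 := by
  rw [← integral_cos_mode hab, ← integral_cos_mode hab, ← integral_sub
    (integrableOn_of_continuous (by fun_prop)) (integrableOn_of_continuous (by fun_prop)),
    ← integral_div]
  congr 1; funext x
  have h1 : (((m : ℤ) - n : ℤ) : ℝ) * Real.pi / (b - a) * (x - a)
    = kap a b m * (x - a) - kap a b n * (x - a) := by unfold kap; push_cast; ring
  have h2 : (((m : ℤ) + n : ℤ) : ℝ) * Real.pi / (b - a) * (x - a)
    = kap a b m * (x - a) + kap a b n * (x - a) := by unfold kap; push_cast; ring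
  rw [h1, h2, Real.cos_sub, Real.cos_add]; ring

lemma integral_es_mul_es {a b : ℝ} (hab : a < b) (m n : ℕ) :
    ∫ x in Ioo a b, es a b m x * es a b n x = if m = n then 1 else 0 := by
  have hL : 0 < b - a := sub_pos.2 hab
  have h : ∀ x, es a b m x * es a b n x = 2 / (b - a) *
      (Real.sin (kap a b (m + 1) * (x - a)) * Real.sin (kap a b (n + 1) * (x - a))) := by
    intro x
    have : bet a b * bet a b = 2 / (b - a) := Real.mul_self_sqrt (by positivity)
    rw [← this]; unfold es; ring
  simp_rw [h]
  rw [integral_const_mul, integral_sin_mul_sin hab]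
  have h2 : ¬ (((m + 1 : ℕ) : ℤ) + ((n + 1 : ℕ) : ℤ) = 0) := by omega
  rw [if_neg h2]
  by_cases hmn : m = n
  · subst hmn; simp [hL.ne']
  · have h3 : ¬ (((m + 1 : ℕ) : ℤ) - ((n + 1 : ℕ) : ℤ) = 0) := by omega
    rw [if_neg h3, if_neg hmn]; simp

lemma integral_ec_mul_ec {a b : ℝ} (hab : a < b) (m n : ℕ) :
    ∫ x in Ioo a b, ec a b m x * ec a b n x = if m = n then 1 else 0 := by
  have hL : 0 < b - a := sub_pos.2 hab
  have h1 : bet a b * bet a b = 2 / (b - a) := Real.mul_self_sqrt (by positivity)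
  have h0 : √(1 / (b - a)) * √(1 / (b - a)) = 1 / (b - a) := Real.mul_self_sqrt (by positivity)
  have h : ∀ x, ec a b m x * ec a b n x =
      ((if m = 0 then √(1 / (b - a)) else bet a b) * (if n = 0 then √(1 / (b - a)) else bet a b)) *
      (Real.cos (kap a b m * (x - a)) * Real.cos (kap a b n * (x - a))) := by
    intro x
    unfold ec; ring
  simp_rw [h]
  rw [integral_const_mul, integral_cos_mul_cos hab]
  by_cases hmn : m = n
  · subst hmn
    by_cases hm : m = 0
    · subst hm; simp only [if_true]; rw [h0]; simp; field_simp
    · have h3 : ¬ ((m : ℤ) + m = 0) := by omega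
      simp only [if_neg hm]
      rw [h1]; simp [hm, hL.ne']
  · have h3 : ¬ ((m : ℤ) - n = 0) := by omega
    have h4 : ¬ ((m : ℤ) + n = 0) := by omega
    rw [if_neg h3, if_neg h4, if_neg hmn]; simp

lemma integrableOn_mul_bdd {a b : ℝ} {G g : ℝ → ℝ} (hG : IntegrableOn G (Ioo a b))
    (hg : Continuous g) : IntegrableOn (fun x => G x * g x) (Ioo a b) := by
  rw [← integrableOn_Icc_iff_integrableOn_Ioo] at hG ⊢
  exact hG.mul_continuousOn hg.continuousOn isCompact_Icc

/-- An integrable function that is orthogonal to all powers of `cos (π (x - a) / (b - a))`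
vanishes almost everywhere. -/
lemma ae_zero_of_integral_cos_pow {a b : ℝ} (hab : a < b) {G : ℝ → ℝ}
    (hG : IntegrableOn G (Ioo a b))
    (h : ∀ m : ℕ, ∫ x in Ioo a b, G x * Real.cos (kap a b 1 * (x - a)) ^ m = 0) :
    G =ᵐ[volume.restrict (Ioo a b)] 0 := by
  have hL : 0 < b - a := sub_pos.2 hab
  have hpoly : ∀ P : Polynomial ℝ,
      ∫ x in Ioo a b, G x * P.eval (Real.cos (kap a b 1 * (x - a))) = 0 := by
    intro P
    simp_rw [Polynomial.eval_eq_sum_range, Finset.mul_sum]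
    rw [integral_finsetSum]
    · refine Finset.sum_eq_zero fun m _ => ?_
      have : ∀ x, G x * (P.coeff m * Real.cos (kap a b 1 * (x - a)) ^ m)
        = P.coeff m * (G x * Real.cos (kap a b 1 * (x - a)) ^ m) := fun x => by ring
      simp_rw [this]
      rw [integral_const_mul, h, mul_zero]
    · intro m _
      exact integrableOn_mul_bdd hG (by fun_prop)
  have hcont : ∀ g : ℝ → ℝ, Continuous g → ∫ x in Ioo a b, G x * g x = 0 := by
    intro g hg
    have hF : Continuous fun y => g (a + (b - a) / Real.pi * Real.arccos y) := by fun_prop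
    have hFx : ∀ x ∈ Ioo a b,
        g (a + (b - a) / Real.pi * Real.arccos (Real.cos (kap a b 1 * (x - a)))) = g x := by
      intro x hx
      have hpi := Real.pi_pos
      rw [Real.arccos_cos]
      · congr 1
        unfold kap; field_simp; simp
      · have := hx.1
        have : 0 < x - a := by linarith
        unfold kap; positivity
      · unfold kap
        rw [div_mul_eq_mul_div, div_le_iff₀ hL]
        have : x - a ≤ b - a := by linarith [hx.2]
        simp only [Nat.cast_one, one_mul]
        gcongr
    by_contra hne
    set I := ∫ x in Ioo a b, |G x| with hI
    have hI0 : 0 ≤ I := integral_nonneg fun _ => abs_nonneg _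
    have hpos : 0 < |∫ x in Ioo a b, G x * g x| := abs_pos.2 hne
    obtain ⟨P, hP⟩ := exists_polynomial_near_of_continuousOn (-1) 1 _ hF.continuousOn
      (|∫ x in Ioo a b, G x * g x| / (I + 1)) (by positivity)
    set ε := |∫ x in Ioo a b, G x * g x| / (I + 1) with hε
    have hi1 := integrableOn_mul_bdd hG hg
    have hi2 : IntegrableOn (fun x => G x * P.eval (Real.cos (kap a b 1 * (x - a)))) (Ioo a b) :=
      integrableOn_mul_bdd hG (P.continuous.comp (by fun_prop))
    have h1 : ∫ x in Ioo a b, G x * g x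
        = ∫ x in Ioo a b, (G x * g x - G x * P.eval (Real.cos (kap a b 1 * (x - a)))) := by
      rw [integral_sub hi1 hi2, hpoly, sub_zero]
    have h2 : |∫ x in Ioo a b, G x * g x| ≤ ∫ x in Ioo a b, |G x| * ε := by
      rw [h1]
      refine (abs_integral_le_integral_abs).trans ?_
      refine setIntegral_mono_on (hi1.sub hi2).abs (hG.abs.mul_const _) measurableSet_Ioo ?_
      intro x hx
      rw [← mul_sub, abs_mul]
      gcongr
      have := hP (Real.cos (kap a b 1 * (x - a))) ⟨Real.neg_one_le_cos _, Real.cos_le_one _⟩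
      rw [hFx x hx, abs_sub_comm] at this
      exact this.le
    rw [integral_mul_const, ← hI] at h2
    have h3 : ε * (I + 1) = |∫ x in Ioo a b, G x * g x| := by
      rw [hε]; field_simp
    have h4 : 0 < ε := by rw [hε]; positivity
    nlinarith
  have h1 : ∀ᵐ x, x ∈ Ioo a b → G x = 0 := by
    refine isOpen_Ioo.ae_eq_zero_of_integral_contDiff_smul_eq_zero hG.locallyIntegrableOn ?_
    intro η h1 h2 h3
    rw [← hcont η h1.continuous, ← setIntegral_eq_integral_of_forall_compl_eq_zero (s := Ioo a b)]
    · simp [mul_comm]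
    · intro t ht
      rw [image_eq_zero_of_notMem_tsupport (fun h => ht (h3 h)), zero_smul]
  rw [EventuallyEq, ae_restrict_iff' measurableSet_Ioo]
  exact h1

lemma integral_cos_pow_mul_cos {a b : ℝ} {G : ℝ → ℝ} (hG : IntegrableOn G (Ioo a b))
    (h : ∀ n : ℕ, ∫ x in Ioo a b, G x * Real.cos (kap a b n * (x - a)) = 0) (m : ℕ) :
    ∀ n : ℕ, ∫ x in Ioo a b,
      G x * (Real.cos (kap a b 1 * (x - a)) ^ m * Real.cos (kap a b n * (x - a))) = 0 := by
  induction m with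
  | zero => simpa using h
  | succ m ih =>
    have key : ∀ n : ℕ, ∀ x, G x * (Real.cos (kap a b 1 * (x - a)) ^ (m + 1)
        * Real.cos (kap a b (n + 1 : ℕ) * (x - a)))
        = (1 / 2) * (G x * (Real.cos (kap a b 1 * (x - a)) ^ m
            * Real.cos (kap a b (n + 2 : ℕ) * (x - a)))
          + G x * (Real.cos (kap a b 1 * (x - a)) ^ m * Real.cos (kap a b n * (x - a)))) := by
      intro n x
      have h1 : kap a b (n + 2 : ℕ) * (x - a)
          = kap a b (n + 1 : ℕ) * (x - a) + kap a b 1 * (x - a) := by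
        unfold kap; push_cast; ring
      have h2 : kap a b n * (x - a)
          = kap a b (n + 1 : ℕ) * (x - a) - kap a b 1 * (x - a) := by
        unfold kap; push_cast; ring
      rw [h1, h2, Real.cos_add, Real.cos_sub]; ring
    intro n
    cases n with
    | zero =>
      have := ih 1
      refine Eq.trans ?_ this
      congr 1; funext x
      have h0 : kap a b 0 = 0 := by simp [kap]
      rw [h0, zero_mul, Real.cos_zero]
      ring
    | succ n =>
      simp_rw [key]
      rw [integral_const_mul, integral_add (integrableOn_mul_bdd hG (by fun_prop))
        (integrableOn_mul_bdd hG (by fun_prop)), ih, ih]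
      simp

lemma integral_cos_pow_mul_sin {a b : ℝ} {G : ℝ → ℝ} (hG : IntegrableOn G (Ioo a b))
    (h : ∀ n : ℕ, ∫ x in Ioo a b, G x * Real.sin (kap a b n * (x - a)) = 0) (m : ℕ) :
    ∀ n : ℕ, ∫ x in Ioo a b,
      G x * (Real.cos (kap a b 1 * (x - a)) ^ m * Real.sin (kap a b n * (x - a))) = 0 := by
  induction m with
  | zero => simpa using h
  | succ m ih =>
    have key : ∀ n : ℕ, ∀ x, G x * (Real.cos (kap a b 1 * (x - a)) ^ (m + 1)
        * Real.sin (kap a b (n + 1 : ℕ) * (x - a)))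
        = (1 / 2) * (G x * (Real.cos (kap a b 1 * (x - a)) ^ m
            * Real.sin (kap a b (n + 2 : ℕ) * (x - a)))
          + G x * (Real.cos (kap a b 1 * (x - a)) ^ m * Real.sin (kap a b n * (x - a)))) := by
      intro n x
      have h1 : kap a b (n + 2 : ℕ) * (x - a)
          = kap a b (n + 1 : ℕ) * (x - a) + kap a b 1 * (x - a) := by
        unfold kap; push_cast; ring
      have h2 : kap a b n * (x - a)
          = kap a b (n + 1 : ℕ) * (x - a) - kap a b 1 * (x - a) := by
        unfold kap; push_cast; ring
      rw [h1, h2, Real.sin_add, Real.sin_sub]; ring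
    intro n
    cases n with
    | zero => simp [kap]
    | succ n =>
      simp_rw [key]
      rw [integral_const_mul, integral_add (integrableOn_mul_bdd hG (by fun_prop))
        (integrableOn_mul_bdd hG (by fun_prop)), ih, ih]
      simp

lemma ae_zero_of_integral_ec {a b : ℝ} (hab : a < b) {G : ℝ → ℝ} (hG : IntegrableOn G (Ioo a b))
    (h : ∀ n : ℕ, ∫ x in Ioo a b, G x * ec a b n x = 0) :
    G =ᵐ[volume.restrict (Ioo a b)] 0 := by
  have hL : 0 < b - a := sub_pos.2 hab
  refine ae_zero_of_integral_cos_pow hab hG fun m => ?_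
  have h1 : ∀ n : ℕ, ∫ x in Ioo a b, G x * Real.cos (kap a b n * (x - a)) = 0 := by
    intro n
    have h2 := h n
    unfold ec at h2
    have h3 : ∀ x, G x * ((if n = 0 then √(1 / (b - a)) else bet a b)
        * Real.cos (kap a b n * (x - a))) = (if n = 0 then √(1 / (b - a)) else bet a b)
        * (G x * Real.cos (kap a b n * (x - a))) := fun x => by ring
    simp_rw [h3] at h2
    rw [integral_const_mul] at h2
    refine (mul_eq_zero.1 h2).resolve_left ?_
    unfold bet
    split_ifs <;> positivity
  have := integral_cos_pow_mul_cos hG h1 m 0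
  simpa [kap] using this

lemma ae_zero_of_integral_es {a b : ℝ} (hab : a < b) {G : ℝ → ℝ} (hG : IntegrableOn G (Ioo a b))
    (h : ∀ n : ℕ, ∫ x in Ioo a b, G x * es a b n x = 0) :
    G =ᵐ[volume.restrict (Ioo a b)] 0 := by
  have hL : 0 < b - a := sub_pos.2 hab
  have h1 : ∀ n : ℕ, ∫ x in Ioo a b, G x * Real.sin (kap a b n * (x - a)) = 0 := by
    intro n
    cases n with
    | zero => simp [kap]
    | succ n =>
      have h2 := h n
      unfold es at h2
      have h3 : ∀ x, G x * (bet a b * Real.sin (kap a b (n + 1) * (x - a)))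
        = bet a b * (G x * Real.sin (kap a b (n + 1) * (x - a))) := fun x => by ring
      simp_rw [h3] at h2
      rw [integral_const_mul] at h2
      refine (mul_eq_zero.1 h2).resolve_left ?_
      unfold bet
      positivity
  have h2 : (fun x => G x * Real.sin (kap a b 1 * (x - a)))
      =ᵐ[volume.restrict (Ioo a b)] 0 := by
    refine ae_zero_of_integral_cos_pow hab (integrableOn_mul_bdd hG (by fun_prop)) fun m => ?_
    rw [← integral_cos_pow_mul_sin hG h1 m 1]
    congr 1; funext x; ring
  filter_upwards [h2, ae_restrict_mem measurableSet_Ioo] with x hx hxm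
  refine (mul_eq_zero.1 hx).resolve_right ?_
  refine (Real.sin_pos_of_pos_of_lt_pi ?_ ?_).ne'
  · have : 0 < x - a := by linarith [hxm.1]
    have := Real.pi_pos
    unfold kap; positivity
  · unfold kap
    rw [div_mul_eq_mul_div, div_lt_iff₀ hL]
    have : x - a < b - a := by linarith [hxm.2]
    have := Real.pi_pos
    simp only [Nat.cast_one, one_mul]
    gcongr

lemma MemL2.memLp {a b : ℝ} {g : ℝ → ℝ} (hg : MemL2 a b g) :
    MemLp g 2 (volume.restrict (Ioo a b)) :=
  (memLp_two_iff_integrable_sq hg.1).2 hg.2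

lemma MemLp.memL2 {a b : ℝ} {g : ℝ → ℝ} (hg : MemLp g 2 (volume.restrict (Ioo a b))) :
    MemL2 a b g :=
  ⟨hg.1, hg.integrable_sq⟩

lemma MemL2.integrable_mul {a b : ℝ} {g h : ℝ → ℝ} (hg : MemL2 a b g) (hh : MemL2 a b h) :
    IntegrableOn (fun x => g x * h x) (Ioo a b) :=
  hg.memLp.integrable_mul hh.memLp

lemma MemL2.integrable {a b : ℝ} {g : ℝ → ℝ} (hg : MemL2 a b g) : IntegrableOn g (Ioo a b) :=
  hg.memLp.integrable (by norm_num)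

lemma MemL2.sub {a b : ℝ} {g h : ℝ → ℝ} (hg : MemL2 a b g) (hh : MemL2 a b h) :
    MemL2 a b (fun x => g x - h x) :=
  MemLp.memL2 (hg.memLp.sub hh.memLp)

lemma MemL2.abs {a b : ℝ} {g : ℝ → ℝ} (hg : MemL2 a b g) : MemL2 a b (fun x => |g x|) :=
  MemLp.memL2 hg.memLp.abs

lemma memL2_of_continuous {a b : ℝ} {g : ℝ → ℝ} (hg : Continuous g) : MemL2 a b g :=
  ⟨hg.aestronglyMeasurable, integrableOn_of_continuous (by fun_prop)⟩

lemma inner_toLp_eq {a b : ℝ} {g h : ℝ → ℝ} (hg : MemLp g 2 (volume.restrict (Ioo a b)))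
    (hh : MemLp h 2 (volume.restrict (Ioo a b))) :
    inner ℝ (hg.toLp g) (hh.toLp h) = ∫ x in Ioo a b, g x * h x := by
  rw [L2.inner_def]
  apply integral_congr_ae
  filter_upwards [hg.coeFn_toLp, hh.coeFn_toLp] with x h1 h2
  rw [h1, h2]; simp [mul_comm]

lemma abs_integral_mul_le {a b : ℝ} {g h : ℝ → ℝ} (hg : MemL2 a b g) (hh : MemL2 a b h) :
    |∫ x in Ioo a b, g x * h x| ≤ √(sqOm a b g) * √(sqOm a b h) := by
  have h1 : ∀ {k : ℝ → ℝ} (hk : MemL2 a b k), ‖hk.memLp.toLp k‖ = √(sqOm a b k) := by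
    intro k hk
    rw [norm_eq_sqrt_real_inner, inner_toLp_eq]
    simp [sqOm, sq]
  rw [← inner_toLp_eq hg.memLp hh.memLp, ← h1 hg, ← h1 hh]
  exact abs_real_inner_le_norm _ _

/-- Orthonormality of a sequence of functions in `L²(a,b)`. -/
structure OrthoSeq (a b : ℝ) (e : ℕ → ℝ → ℝ) : Prop where
  mem : ∀ n, MemL2 a b (e n)
  ortho : ∀ m n, ∫ x in Ioo a b, e m x * e n x = if m = n then 1 else 0

lemma orthoSeq_es {a b : ℝ} (hab : a < b) : OrthoSeq a b (es a b) :=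
  ⟨fun n => memL2_of_continuous (continuous_es a b n), integral_es_mul_es hab⟩

lemma orthoSeq_ec {a b : ℝ} (hab : a < b) : OrthoSeq a b (ec a b) :=
  ⟨fun n => memL2_of_continuous (continuous_ec a b n), integral_ec_mul_ec hab⟩

lemma OrthoSeq.succ {a b : ℝ} {e : ℕ → ℝ → ℝ} (he : OrthoSeq a b e) :
    OrthoSeq a b (fun n => e (n + 1)) :=
  ⟨fun n => he.mem _, fun m n => by rw [he.ortho]; simp⟩

lemma OrthoSeq.orthonormal {a b : ℝ} {e : ℕ → ℝ → ℝ} (he : OrthoSeq a b e) :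
    Orthonormal ℝ (fun n => (he.mem n).memLp.toLp (e n)) := by
  rw [orthonormal_iff_ite]
  intro m n
  rw [inner_toLp_eq, he.ortho]

lemma OrthoSeq.bessel {a b : ℝ} {e : ℕ → ℝ → ℝ} (he : OrthoSeq a b e) {g : ℝ → ℝ}
    (hg : MemL2 a b g) (s : Finset ℕ) :
    ∑ n ∈ s, (∫ x in Ioo a b, g x * e n x) ^ 2 ≤ sqOm a b g := by
  have h := he.orthonormal.sum_inner_products_le (hg.memLp.toLp g) (s := s)
  have h1 : ‖hg.memLp.toLp g‖ ^ 2 = sqOm a b g := by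
    rw [← real_inner_self_eq_norm_sq, inner_toLp_eq]; simp [sqOm, sq]
  rw [h1] at h
  refine le_trans (le_of_eq (Finset.sum_congr rfl fun n _ => ?_)) h
  rw [inner_toLp_eq, Real.norm_eq_abs, sq_abs]
  simp [mul_comm]

lemma OrthoSeq.parseval {a b : ℝ} {e : ℕ → ℝ → ℝ} (he : OrthoSeq a b e)
    (hc : ∀ G, IntegrableOn G (Ioo a b) → (∀ n, ∫ x in Ioo a b, G x * e n x = 0) →
      G =ᵐ[volume.restrict (Ioo a b)] 0)
    {g h : ℝ → ℝ} (hg : MemL2 a b g) (hh : MemL2 a b h) :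
    HasSum (fun n => (∫ x in Ioo a b, g x * e n x) * ∫ x in Ioo a b, h x * e n x)
      (∫ x in Ioo a b, g x * h x) := by
  have hbot : (Submodule.span ℝ (Set.range fun n => (he.mem n).memLp.toLp (e n)))ᗮ = ⊥ := by
    rw [Submodule.eq_bot_iff]
    intro v hv
    have hv2 : MemL2 a b v := MemLp.memL2 (Lp.memLp v)
    have h0 : ∀ n, ∫ x in Ioo a b, v x * e n x = 0 := by
      intro n
      have h1 := (Submodule.mem_orthogonal _ _).1 hv _ (Submodule.subset_span ⟨n, rfl⟩)
      have h2 : v = hv2.memLp.toLp v := (Lp.toLp_coeFn v _).symm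
      rw [h2, inner_toLp_eq] at h1
      simpa [mul_comm] using h1
    exact (Lp.eq_zero_iff_ae_eq_zero).2 (hc _ hv2.integrable h0)
  have h := (HilbertBasis.mkOfOrthogonalEqBot he.orthonormal hbot).hasSum_inner_mul_inner
    (hg.memLp.toLp g) (hh.memLp.toLp h)
  simp only [HilbertBasis.coe_mkOfOrthogonalEqBot, inner_toLp_eq] at h
  simpa [mul_comm] using h

lemma parseval_es {a b : ℝ} (hab : a < b) {g h : ℝ → ℝ} (hg : MemL2 a b g) (hh : MemL2 a b h) :
    HasSum (fun n => (∫ x in Ioo a b, g x * es a b n x) * ∫ x in Ioo a b, h x * es a b n x)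
      (∫ x in Ioo a b, g x * h x) :=
  (orthoSeq_es hab).parseval (fun _ => ae_zero_of_integral_es hab) hg hh

lemma abs_sum_mul_le_sqrt (s : Finset ℕ) (x y : ℕ → ℝ) {X Y : ℝ}
    (hx : ∑ n ∈ s, x n ^ 2 ≤ X) (hy : ∑ n ∈ s, y n ^ 2 ≤ Y) :
    ∑ n ∈ s, |x n| * |y n| ≤ √X * √Y := by
  have h := Real.sum_mul_le_sqrt_mul_sqrt s (fun n => |x n|) (fun n => |y n|)
  simp only [sq_abs] at h
  refine h.trans ?_
  gcongr

lemma OrthoSeq.sum_abs_mul_le {a b : ℝ} {e : ℕ → ℝ → ℝ} (he : OrthoSeq a b e) {g h : ℝ → ℝ}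
    (hg : MemL2 a b g) (hh : MemL2 a b h) (s : Finset ℕ) :
    ∑ n ∈ s, |∫ x in Ioo a b, g x * e n x| * |∫ x in Ioo a b, h x * e n x|
      ≤ √(sqOm a b g) * √(sqOm a b h) :=
  abs_sum_mul_le_sqrt s _ _ (he.bessel hg s) (he.bessel hh s)

lemma exists_bound_deriv_smoothTransition :
    ∃ C : ℝ, 0 ≤ C ∧ ∀ y, |deriv Real.smoothTransition y| ≤ C := by
  have hs : ContDiff ℝ (⊤ : ℕ∞) Real.smoothTransition := Real.smoothTransition.contDiff
  have hc : Continuous (deriv Real.smoothTransition) := (contDiff_infty_iff_deriv.1 hs).2.continuous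
  obtain ⟨C, hC⟩ := (isCompact_Icc (a := (0 : ℝ)) (b := 1)).exists_bound_of_continuousOn
    hc.continuousOn
  refine ⟨max C 0, le_max_right _ _, fun y => ?_⟩
  by_cases hy : y ∈ Icc (0 : ℝ) 1
  · exact (hC y hy).trans (le_max_left _ _)
  · have : deriv Real.smoothTransition y = 0 := by
      rw [mem_Icc, not_and_or, not_le, not_le] at hy
      rcases hy with hy | hy
      · have : Real.smoothTransition =ᶠ[nhds y] fun _ => 0 := by
          filter_upwards [gt_mem_nhds hy] with z hz
          exact Real.smoothTransition.zero_of_nonpos hz.le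
        rw [this.deriv_eq]; simp
      · have : Real.smoothTransition =ᶠ[nhds y] fun _ => 1 := by
          filter_upwards [lt_mem_nhds hy] with z hz
          exact Real.smoothTransition.one_of_one_le hz.le
        rw [this.deriv_eq]; simp
    rw [this, abs_zero]; exact le_max_right _ _

lemma deriv_smoothTransition_of_one_lt {y : ℝ} (hy : 1 < y) :
    deriv Real.smoothTransition y = 0 := by
  have : Real.smoothTransition =ᶠ[nhds y] fun _ => 1 := by
    filter_upwards [lt_mem_nhds hy] with z hz
    exact Real.smoothTransition.one_of_one_le hz.le
  rw [this.deriv_eq]; simp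

lemma abs_es_le_dist {a b : ℝ} (hab : a < b) (n : ℕ) :
    ∃ C : ℝ, 0 ≤ C ∧ ∀ x ∈ Ioo a b, |es a b n x| ≤ C * ((x - a) * (b - x)) := by
  have hL : 0 < b - a := sub_pos.2 hab
  set C := kap a b (n + 1) * bet a b with hC
  have hC0 : 0 ≤ C := mul_nonneg (kap_pos hab n).le (bet_nonneg a b)
  have hlip : ∀ x y, |es a b n y - es a b n x| ≤ C * |y - x| := by
    intro x y
    have := Convex.norm_image_sub_le_of_norm_deriv_le (f := es a b n) (C := C) (s := univ)
      (fun x _ => (hasDerivAt_es a b n x).differentiableAt) (fun x _ => by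
        rw [deriv_es, Real.norm_eq_abs, abs_mul, abs_of_pos (kap_pos hab n)]
        exact mul_le_mul_of_nonneg_left (abs_ec_le hab _ _) (kap_pos hab n).le)
      convex_univ (mem_univ x) (mem_univ y)
    simpa using this
  refine ⟨C * (2 / (b - a)), by positivity, fun x hx => ?_⟩
  have h1 : 0 < x - a := by linarith [hx.1]
  have h2 : 0 < b - x := by linarith [hx.2]
  have ha := hlip a x
  have hb := hlip b x
  rw [es_left, sub_zero, abs_of_pos h1] at ha
  rw [es_right hab, sub_zero, abs_sub_comm x b, abs_of_pos h2] at hb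
  rw [mul_assoc, div_mul_eq_mul_div]
  rcases le_total (x - a) (b - x) with h | h
  · refine ha.trans (mul_le_mul_of_nonneg_left ?_ hC0)
    rw [le_div_iff₀ hL]; nlinarith
  · refine hb.trans (mul_le_mul_of_nonneg_left ?_ hC0)
    rw [le_div_iff₀ hL]; nlinarith

/-- Dirichlet modes are limits of smooth functions with compact support in `(a,b)`,
with uniformly bounded derivatives. -/
lemma exists_compactly_supported_approx {a b : ℝ} (hab : a < b) (n : ℕ) :
    ∃ (ψ : ℕ → ℝ → ℝ) (C : ℝ), (∀ j, ContDiff ℝ (⊤ : ℕ∞) (ψ j)) ∧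
      (∀ j, ∃ K : Set ℝ, IsCompact K ∧ K ⊆ Ioo a b ∧ ∀ x, x ∉ K → ψ j x = 0) ∧
      (∀ j, ∀ x ∈ Ioo a b, |ψ j x| ≤ C ∧ |deriv (ψ j) x| ≤ C) ∧
      ∀ x ∈ Ioo a b, ∀ᶠ j in atTop, ψ j x = es a b n x ∧ deriv (ψ j) x = deriv (es a b n) x := by
  have hL : 0 < b - a := sub_pos.2 hab
  obtain ⟨C1, hC1, hst⟩ := exists_bound_deriv_smoothTransition
  obtain ⟨C2, hC2, hes⟩ := abs_es_le_dist hab n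
  have hk := kap_pos hab n
  have hβ := bet_nonneg a b
  set d : ℝ → ℝ := fun x => (x - a) * (b - x) with hd
  have hsmooth : ContDiff ℝ (⊤ : ℕ∞) Real.smoothTransition := Real.smoothTransition.contDiff
  set η : ℕ → ℝ → ℝ := fun j x => Real.smoothTransition (j * d x - 1) with hη
  have hηs : ∀ j, ContDiff ℝ (⊤ : ℕ∞) (η j) := fun j => hsmooth.comp (by fun_prop)
  have hηd : ∀ j x, HasDerivAt (η j)
      (deriv Real.smoothTransition (j * d x - 1) * (j * (b + a - 2 * x))) x := by
    intro j x
    have h1 : HasDerivAt (fun x => (j : ℝ) * d x - 1) (j * (b + a - 2 * x)) x := by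
      have h2 : HasDerivAt d (1 * (b - x) + (x - a) * (-1)) x :=
        ((hasDerivAt_id x).sub_const a).mul ((hasDerivAt_id x).const_sub b)
      exact ((h2.const_mul (j : ℝ)).sub_const 1).congr_deriv (by ring)
    exact ((hsmooth.differentiable (by simp) _).hasDerivAt).comp x h1
  have hψd : ∀ j x, deriv (fun x => es a b n x * η j x) x = deriv (es a b n) x * η j x
      + es a b n x * (deriv Real.smoothTransition (j * d x - 1) * (j * (b + a - 2 * x))) := by
    intro j x
    rw [deriv_es]
    exact ((hasDerivAt_es a b n x).mul (hηd j x)).deriv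
  have hη1 : ∀ j x, |η j x| ≤ 1 := fun j x => by
    rw [abs_of_nonneg (Real.smoothTransition.nonneg _)]
    exact Real.smoothTransition.le_one _
  refine ⟨fun j x => es a b n x * η j x, bet a b + kap a b (n + 1) * bet a b
    + 2 * C2 * C1 * (b - a), fun j => (contDiff_es a b n).mul (hηs j), ?_, ?_, ?_⟩
  · intro j
    refine ⟨Icc a b ∩ {x | 1 ≤ j * d x}, ?_, ?_, ?_⟩
    · exact isCompact_Icc.inter_right (isClosed_le (by fun_prop) (by fun_prop))
    · rintro x ⟨⟨h1, h2⟩, h3⟩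
      simp only [mem_ofPred_eq, hd] at h3
      refine ⟨lt_of_le_of_ne h1 ?_, lt_of_le_of_ne h2 ?_⟩
      · rintro rfl; norm_num at h3
      · rintro rfl; norm_num at h3
    · intro x hx
      have : j * d x - 1 ≤ 0 := by
        by_contra hcon
        push Not at hcon
        have hj : (0 : ℝ) ≤ j := Nat.cast_nonneg j
        have hdx : 0 < d x := by
          by_contra hneg
          push Not at hneg
          nlinarith
        apply hx
        refine ⟨⟨?_, ?_⟩, by simp only [mem_ofPred_eq]; linarith⟩
        · by_contra hxa
          push Not at hxa
          simp only [hd] at hdx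
          nlinarith
        · by_contra hxa
          push Not at hxa
          simp only [hd] at hdx
          nlinarith
      simp only [hη]
      rw [Real.smoothTransition.zero_of_nonpos this, mul_zero]
  · intro j x hx
    have h1 : 0 < x - a := by linarith [hx.1]
    have h2 : 0 < b - x := by linarith [hx.2]
    have hdx : 0 < d x := mul_pos h1 h2
    have hA : |es a b n x * η j x| ≤ bet a b := by
      rw [abs_mul]
      calc _ ≤ bet a b * 1 := mul_le_mul (abs_es_le a b n x) (hη1 j x) (abs_nonneg _) hβ
        _ = _ := mul_one _
    have hB : |deriv (es a b n) x * η j x| ≤ kap a b (n + 1) * bet a b := by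
      rw [abs_mul, deriv_es, abs_mul, abs_of_pos hk]
      calc _ ≤ (kap a b (n + 1) * bet a b) * 1 := by
            gcongr
            · exact abs_ec_le hab _ _
            · exact hη1 j x
        _ = _ := mul_one _
    have hD : |es a b n x * (deriv Real.smoothTransition (j * d x - 1)
        * (j * (b + a - 2 * x)))| ≤ 2 * C2 * C1 * (b - a) := by
      by_cases hj : 1 < j * d x - 1
      · rw [deriv_smoothTransition_of_one_lt hj]; simp; positivity
      · push Not at hj
        have hj' : (j : ℝ) * d x ≤ 2 := by linarith
        have h3 : |es a b n x| * j ≤ 2 * C2 := by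
          calc |es a b n x| * j ≤ C2 * d x * j := by gcongr; exact hes x hx
            _ = C2 * (j * d x) := by ring
            _ ≤ C2 * 2 := by gcongr
            _ = 2 * C2 := by ring
        have h4 : |b + a - 2 * x| ≤ b - a := by
          rw [abs_le]; constructor <;> linarith
        rw [abs_mul, abs_mul, abs_mul, Nat.abs_cast]
        calc _ = (|es a b n x| * j) * |deriv Real.smoothTransition (j * d x - 1)|
              * |b + a - 2 * x| := by ring
          _ ≤ (2 * C2) * C1 * (b - a) := by
            gcongr
            exact hst _
    refine ⟨hA.trans ?_, ?_⟩
    · have : 0 ≤ kap a b (n + 1) * bet a b + 2 * C2 * C1 * (b - a) := by positivity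
      linarith
    · rw [hψd]
      refine (abs_add_le _ _).trans ?_
      linarith
  · intro x hx
    have h1 : 0 < x - a := by linarith [hx.1]
    have h2 : 0 < b - x := by linarith [hx.2]
    have hdx : 0 < d x := mul_pos h1 h2
    have ht : Tendsto (fun j : ℕ => (j : ℝ) * d x) atTop atTop :=
      tendsto_natCast_atTop_atTop.atTop_mul_const hdx
    filter_upwards [ht.eventually_gt_atTop 2] with j hj
    have h3 : η j x = 1 := Real.smoothTransition.one_of_one_le (by linarith)
    refine ⟨by rw [h3, mul_one], ?_⟩
    rw [hψd, h3, deriv_smoothTransition_of_one_lt (by linarith)]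
    ring

lemma tendsto_integral_mul_of_eventually_eq {α : Type*} [MeasurableSpace α] {ν : Measure α}
    {F g : α → ℝ} {gj : ℕ → α → ℝ} {C : ℝ} (hF : Integrable F ν)
    (hm : ∀ j, AEStronglyMeasurable (gj j) ν) (hb : ∀ j, ∀ᵐ x ∂ν, |gj j x| ≤ C)
    (hl : ∀ᵐ x ∂ν, ∀ᶠ j in atTop, gj j x = g x) :
    Tendsto (fun j => ∫ x, F x * gj j x ∂ν) atTop (nhds (∫ x, F x * g x ∂ν)) := by
  refine tendsto_integral_of_dominated_convergence (fun x => |F x| * C)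
    (fun j => hF.1.mul (hm j)) (hF.abs.mul_const C) (fun j => ?_) ?_
  · filter_upwards [hb j] with x hx
    rw [Real.norm_eq_abs, abs_mul]
    gcongr
  · filter_upwards [hl] with x hx
    exact tendsto_const_nhds.congr' (by filter_upwards [hx] with j hj; rw [hj])

lemma volume_restrict_prod (A B : Set ℝ) :
    (volume : Measure (ℝ × ℝ)).restrict (A ×ˢ B)
      = (volume.restrict A).prod (volume.restrict B) := by
  rw [Measure.volume_eq_prod, Measure.prod_restrict]

/-- Integrability on the space-time cylinder. -/
abbrev IntCyl (a b T : ℝ) (F : ℝ → ℝ → ℝ) : Prop :=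
  IntegrableOn (fun p : ℝ × ℝ => F p.1 p.2) ((Ioo a b) ×ˢ (Ioo 0 T))

lemma IntCyl.mul_continuous {a b T : ℝ} {F : ℝ → ℝ → ℝ} (hF : IntCyl a b T F) {g : ℝ × ℝ → ℝ}
    (hg : Continuous g) : IntCyl a b T (fun x t => F x t * g (x, t)) := by
  have hK : IsCompact (Icc a b ×ˢ Icc 0 T) := isCompact_Icc.prod isCompact_Icc
  obtain ⟨C, hC⟩ := hK.exists_bound_of_continuousOn hg.continuousOn
  refine Integrable.mul_bdd (c := C) hF hg.aestronglyMeasurable ?_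
  refine (ae_restrict_mem (measurableSet_Ioo.prod measurableSet_Ioo)).mono ?_
  rintro ⟨x, t⟩ ⟨h1, h2⟩
  exact hC _ ⟨Ioo_subset_Icc_self h1, Ioo_subset_Icc_self h2⟩

lemma IntCyl.slice {a b T : ℝ} {F : ℝ → ℝ → ℝ} (hF : IntCyl a b T F) :
    ∀ᵐ t ∂volume.restrict (Ioo 0 T), IntegrableOn (fun x => F x t) (Ioo a b) := by
  unfold IntCyl IntegrableOn at hF
  rw [volume_restrict_prod] at hF
  exact hF.prod_left_ae

lemma IntCyl.integral_slice {a b T : ℝ} {F : ℝ → ℝ → ℝ} (hF : IntCyl a b T F) :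
    IntegrableOn (fun t => ∫ x in Ioo a b, F x t) (Ioo 0 T) := by
  unfold IntCyl IntegrableOn at hF
  rw [volume_restrict_prod] at hF
  exact hF.integral_prod_right

lemma IntCyl.intOmT_eq {a b T : ℝ} {F : ℝ → ℝ → ℝ} (hF : IntCyl a b T F) :
    intOmT a b T F = ∫ t in Ioo 0 T, ∫ x in Ioo a b, F x t := by
  unfold IntCyl IntegrableOn at hF
  rw [volume_restrict_prod] at hF
  rw [intOmT, volume_restrict_prod, integral_prod_symm _ hF]

lemma IntCyl.coeff_integrable {a b T : ℝ} {F : ℝ → ℝ → ℝ} (hF : IntCyl a b T F) {s : ℝ → ℝ}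
    (hs : Continuous s) : IntegrableOn (fun t => ∫ x in Ioo a b, F x t * s x) (Ioo 0 T) :=
  (hF.mul_continuous (g := fun p => s p.1) (by fun_prop)).integral_slice

lemma IntCyl.intOmT_mul {a b T : ℝ} {F : ℝ → ℝ → ℝ} (hF : IntCyl a b T F) {s χ : ℝ → ℝ}
    (hs : Continuous s) (hχ : Continuous χ) :
    intOmT a b T (fun x t => F x t * (s x * χ t))
      = ∫ t in Ioo 0 T, (∫ x in Ioo a b, F x t * s x) * χ t := by
  have h := (hF.mul_continuous (g := fun p => s p.1 * χ p.2) (by fun_prop)).intOmT_eq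
  rw [h]
  congr 1; funext t
  rw [← integral_mul_const]
  congr 1; funext x; ring

lemma IntCyl.tendsto_intOmT {a b T : ℝ} {F : ℝ → ℝ → ℝ} (hF : IntCyl a b T F) {s χ : ℝ → ℝ}
    {ψ : ℕ → ℝ → ℝ} {C : ℝ} (hψ : ∀ j, Continuous (ψ j)) (hC : ∀ j, ∀ x ∈ Ioo a b, |ψ j x| ≤ C)
    (hl : ∀ x ∈ Ioo a b, ∀ᶠ j in atTop, ψ j x = s x) (hχ : Continuous χ) :
    Tendsto (fun j => intOmT a b T (fun x t => F x t * (ψ j x * χ t))) atTop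
      (nhds (intOmT a b T (fun x t => F x t * (s x * χ t)))) := by
  have hF2 := hF.mul_continuous (g := fun p => χ p.2) (by fun_prop)
  have h := tendsto_integral_mul_of_eventually_eq (gj := fun j (p : ℝ × ℝ) => ψ j p.1)
    (g := fun p : ℝ × ℝ => s p.1) (C := C) hF2
    (fun j => ((hψ j).comp continuous_fst).aestronglyMeasurable)
    (fun j => (ae_restrict_mem (measurableSet_Ioo.prod measurableSet_Ioo)).mono
      fun p hp => hC j _ hp.1)
    ((ae_restrict_mem (measurableSet_Ioo.prod measurableSet_Ioo)).mono fun p hp => hl _ hp.1)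
  have e : ∀ (g : ℝ → ℝ), intOmT a b T (fun x t => F x t * (g x * χ t))
      = ∫ p in (Ioo a b) ×ˢ (Ioo 0 T), F p.1 p.2 * χ p.2 * g p.1 := by
    intro g
    unfold intOmT
    congr 1; funext p; ring
  simp_rw [e]
  exact h

lemma tendsto_intOm_mul {a b : ℝ} {F s : ℝ → ℝ} (hF : IntegrableOn F (Ioo a b))
    {ψ : ℕ → ℝ → ℝ} {C : ℝ} (hψ : ∀ j, Continuous (ψ j)) (hC : ∀ j, ∀ x ∈ Ioo a b, |ψ j x| ≤ C)
    (hl : ∀ x ∈ Ioo a b, ∀ᶠ j in atTop, ψ j x = s x) :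
    Tendsto (fun j => ∫ x in Ioo a b, F x * ψ j x) atTop
      (nhds (∫ x in Ioo a b, F x * s x)) :=
  tendsto_integral_mul_of_eventually_eq (C := C) hF (fun j => (hψ j).aestronglyMeasurable)
    (fun j => (ae_restrict_mem measurableSet_Ioo).mono fun _ hx => hC j _ hx)
    ((ae_restrict_mem measurableSet_Ioo).mono fun _ hx => hl _ hx)

/-- The coefficient of the slice `F(·,t)` against the profile `e`. -/
def slc (a b : ℝ) (e : ℝ → ℝ) (F : ℝ → ℝ → ℝ) (t : ℝ) : ℝ := ∫ x in Ioo a b, F x t * e x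

lemma ContL2.continuousOn_slc {a b T : ℝ} {w : ℝ → ℝ → ℝ} (hw : ContL2 a b (Icc 0 T) w)
    {e : ℝ → ℝ} (he : MemL2 a b e) : ContinuousOn (slc a b e w) (Icc 0 T) := by
  intro t₀ ht₀
  have h1 := (hw.2 t₀ ht₀).sqrt.mul_const √(sqOm a b e)
  rw [Real.sqrt_zero, zero_mul] at h1
  refine tendsto_iff_dist_tendsto_zero.2 ?_
  refine squeeze_zero' (Eventually.of_forall fun _ => dist_nonneg) ?_ h1
  filter_upwards [self_mem_nhdsWithin] with t ht
  have h2 : slc a b e w t - slc a b e w t₀ = ∫ x in Ioo a b, (w x t - w x t₀) * e x := by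
    simp only [slc, sub_mul]
    rw [integral_sub ((hw.1 t ht).integrable_mul he) ((hw.1 t₀ ht₀).integrable_mul he)]
  rw [Real.dist_eq, h2]
  exact abs_integral_mul_le ((hw.1 t ht).sub (hw.1 t₀ ht₀)) he

lemma WeakDerivZ.kap_mul_es {a b : ℝ} {g g' : ℝ → ℝ} (hg : WeakDerivZ a b g g') (n : ℕ) :
    kap a b (n + 1) * ∫ x in Ioo a b, g x * es a b n x
      = ∫ x in Ioo a b, g' x * ec a b (n + 1) x := by
  have h := hg (ec a b (n + 1)) (contDiff_ec a b (n + 1))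
  rw [deriv_ec] at h
  rw [← neg_inj, ← h, ← integral_const_mul, ← integral_neg]
  refine integral_congr_ae (Eventually.of_forall fun x => ?_)
  simp only
  ring

lemma WeakDerivZ.integral_mul_deriv_es {a b : ℝ} {g g' : ℝ → ℝ} (hg : WeakDerivZ a b g g')
    (n : ℕ) : ∫ x in Ioo a b, g' x * deriv (es a b n) x
      = kap a b (n + 1) ^ 2 * ∫ x in Ioo a b, g x * es a b n x := by
  rw [sq, mul_assoc, hg.kap_mul_es n, deriv_es, ← integral_const_mul]
  refine integral_congr_ae (Eventually.of_forall fun x => ?_)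
  simp only
  ring

lemma pdt_mul (ψ χ : ℝ → ℝ) : pdt (fun x t => ψ x * χ t) = fun x t => ψ x * deriv χ t := by
  funext x t
  simp [pdt]

lemma pdx_mul (ψ χ : ℝ → ℝ) : pdx (fun x t => ψ x * χ t) = fun x t => deriv ψ x * χ t := by
  funext x t
  simp [pdx]

lemma contDiff_uncurry_mul {ψ χ : ℝ → ℝ} (hψ : ContDiff ℝ (⊤ : ℕ∞) ψ)
    (hχ : ContDiff ℝ (⊤ : ℕ∞) χ) : ContDiff ℝ (⊤ : ℕ∞) (uncurry fun x t => ψ x * χ t) := by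
  have : (uncurry fun x t => ψ x * χ t) = fun p : ℝ × ℝ => ψ p.1 * χ p.2 := by
    funext p; rfl
  rw [this]
  exact (hψ.comp contDiff_fst).mul (hχ.comp contDiff_snd)

lemma TimeTest.testT {T : ℝ} {χ ψ : ℝ → ℝ} (hχ : TimeTest T χ) (hψ : ContDiff ℝ (⊤ : ℕ∞) ψ) :
    TestT T (fun x t => ψ x * χ t) := by
  obtain ⟨T', h1, h2⟩ := hχ.supp
  exact ⟨contDiff_uncurry_mul hψ hχ.smooth, T', h1, fun x t ht => by rw [h2 t ht, mul_zero]⟩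

lemma TimeTest.testU {a b T : ℝ} {χ ψ : ℝ → ℝ} (hχ : TimeTest T χ)
    (hψ : ContDiff ℝ (⊤ : ℕ∞) ψ)
    (hs : ∃ K : Set ℝ, IsCompact K ∧ K ⊆ Ioo a b ∧ ∀ x, x ∉ K → ψ x = 0) :
    TestU a b T (fun x t => ψ x * χ t) := by
  obtain ⟨K, k1, k2, k3⟩ := hs
  exact ⟨contDiff_uncurry_mul hψ hχ.smooth,
    ⟨K, k1, k2, fun x t hx => by rw [k3 x hx, zero_mul]⟩, (hχ.testT hψ).suppt⟩

section

variable {a b T : ℝ} {f f' : ℝ → ℝ} {u0 u0t Θ0 : ℝ → ℝ} {u ut ux Θ Θx : ℝ → ℝ → ℝ}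

/-- The gradient `(f(Θ))_x`. -/
def gradf (f' : ℝ → ℝ) (Θ Θx : ℝ → ℝ → ℝ) (x t : ℝ) : ℝ := f' (Θ x t) * Θx x t

lemma IsWeakSol.weak_u_mode (hab : a < b)
    (W : IsWeakSol a b T f f' u0 u0t Θ0 u ut ux Θ Θx) (h0 : IntegrableOn u0 (Ioo a b))
    (h0t : IntegrableOn u0t (Ioo a b)) (n : ℕ) {χ : ℝ → ℝ} (hχ : TimeTest T χ) :
    (∫ t in Ioo 0 T, slc a b (es a b n) u t * deriv (deriv χ) t)
        - (∫ x in Ioo a b, u0t x * es a b n x) * χ 0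
        + (∫ x in Ioo a b, u0 x * es a b n x) * deriv χ 0
      = ∫ t in Ioo 0 T, (-(kap a b (n + 1) ^ 2 * slc a b (es a b n) u t)
        - slc a b (es a b n) (gradf f' Θ Θx) t) * χ t := by
  obtain ⟨ψ, C, hψ, hs, hC, hl⟩ := exists_compactly_supported_approx hab n
  have hψc : ∀ j, Continuous (ψ j) := fun j => (hψ j).continuous
  have hψ'c : ∀ j, Continuous (deriv (ψ j)) := fun j => (hψ j).continuous_deriv (by simp)
  have hC1 : ∀ j, ∀ x ∈ Ioo a b, |ψ j x| ≤ C := fun j x hx => (hC j x hx).1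
  have hC2 : ∀ j, ∀ x ∈ Ioo a b, |deriv (ψ j) x| ≤ C := fun j x hx => (hC j x hx).2
  have hl1 : ∀ x ∈ Ioo a b, ∀ᶠ j in atTop, ψ j x = es a b n x :=
    fun x hx => (hl x hx).mono fun j h => h.1
  have hl2 : ∀ x ∈ Ioo a b, ∀ᶠ j in atTop, deriv (ψ j) x = deriv (es a b n) x :=
    fun x hx => (hl x hx).mono fun j h => h.2
  have hec : Continuous (es a b n) := continuous_es a b n
  have hec' : Continuous (deriv (es a b n)) := (contDiff_es a b n).continuous_deriv (by simp)
  have hu : IntCyl a b T u := W.u_int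
  have hux : IntCyl a b T ux := W.ux_int
  have hg : IntCyl a b T (gradf f' Θ Θx) := W.g1_int
  have key : ∀ j, intOmT a b T (fun x t => u x t * (ψ j x * deriv (deriv χ) t))
        - (∫ x in Ioo a b, u0t x * ψ j x) * χ 0 + (∫ x in Ioo a b, u0 x * ψ j x) * deriv χ 0
      = - intOmT a b T (fun x t => ux x t * (deriv (ψ j) x * χ t))
        - intOmT a b T (fun x t => gradf f' Θ Θx x t * (ψ j x * χ t)) := by
    intro j
    have h := W.weak_u _ (hχ.testU (hψ j) (hs j))
    rw [pdt_mul, pdt_mul, pdx_mul] at h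
    simp only [intOm, ← mul_assoc, integral_mul_const] at h
    simp only [gradf, ← mul_assoc]
    exact h
  have l1 := (((hu.tendsto_intOmT hψc hC1 hl1 hχ.deriv.deriv.continuous).sub
    ((tendsto_intOm_mul h0t hψc hC1 hl1).mul_const (χ 0))).add
    ((tendsto_intOm_mul h0 hψc hC1 hl1).mul_const (deriv χ 0)))
  have l2 := ((hux.tendsto_intOmT hψ'c hC2 hl2 hχ.continuous).neg).sub
    (hg.tendsto_intOmT hψc hC1 hl1 hχ.continuous)
  have e := tendsto_nhds_unique (l1.congr key) l2
  rw [hu.intOmT_mul hec hχ.deriv.deriv.continuous, hux.intOmT_mul hec' hχ.continuous,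
    hg.intOmT_mul hec hχ.continuous] at e
  have e2 : ∫ t in Ioo 0 T, (∫ x in Ioo a b, ux x t * deriv (es a b n) x) * χ t
      = ∫ t in Ioo 0 T, kap a b (n + 1) ^ 2 * slc a b (es a b n) u t * χ t := by
    refine integral_congr_ae ?_
    filter_upwards [W.u_W0] with t ht
    simp only [ht.integral_mul_deriv_es n, slc]
  rw [e2] at e
  have i1 : IntegrableOn (fun t => kap a b (n + 1) ^ 2 * slc a b (es a b n) u t * χ t)
      (Ioo 0 T) :=
    Integrable.mul_of_continuousOn ((hu.coeff_integrable hec).const_mul _)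
      hχ.continuous.continuousOn
  have i2 : IntegrableOn (fun t => slc a b (es a b n) (gradf f' Θ Θx) t * χ t) (Ioo 0 T) :=
    Integrable.mul_of_continuousOn (hg.coeff_integrable hec) hχ.continuous.continuousOn
  have e3 : ∫ t in Ioo 0 T, (-(kap a b (n + 1) ^ 2 * slc a b (es a b n) u t)
        - slc a b (es a b n) (gradf f' Θ Θx) t) * χ t
      = -(∫ t in Ioo 0 T, kap a b (n + 1) ^ 2 * slc a b (es a b n) u t * χ t)
        - ∫ t in Ioo 0 T, slc a b (es a b n) (gradf f' Θ Θx) t * χ t := by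
    rw [← integral_neg]
    refine Eq.trans ?_ (integral_sub i1.neg i2)
    refine integral_congr_ae (Eventually.of_forall fun t => ?_)
    simp only
    ring
  rw [e3]
  exact e

/-- The source of the `n`-th mode of the wave equation. -/
def waveSrc (a b : ℝ) (f' : ℝ → ℝ) (u Θ Θx : ℝ → ℝ → ℝ) (n : ℕ) (t : ℝ) : ℝ :=
  -(kap a b (n + 1) ^ 2 * slc a b (es a b n) u t) - slc a b (es a b n) (gradf f' Θ Θx) t

lemma IsWeakSol.integrable_waveSrc (W : IsWeakSol a b T f f' u0 u0t Θ0 u ut ux Θ Θx) (n : ℕ) :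
    IntegrableOn (waveSrc a b f' u Θ Θx n) (Ioo 0 T) := by
  have hu : IntCyl a b T u := W.u_int
  have hg : IntCyl a b T (gradf f' Θ Θx) := W.g1_int
  exact ((hu.coeff_integrable (continuous_es a b n)).const_mul _).neg.sub
    (hg.coeff_integrable (continuous_es a b n))

lemma IsWeakSol.u_mode (hab : a < b) (hT : 0 < T)
    (W : IsWeakSol a b T f f' u0 u0t Θ0 u ut ux Θ Θx) (R : RegT a b T u ut ux Θ Θx)
    (h0 : IntegrableOn u0 (Ioo a b)) (h0t : IntegrableOn u0t (Ioo a b)) (n : ℕ) :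
    EqOn (slc a b (es a b n) u) (prim (∫ x in Ioo a b, u0 x * es a b n x)
      (prim (∫ x in Ioo a b, u0t x * es a b n x) (waveSrc a b f' u Θ Θx n))) (Icc 0 T) := by
  have hu : IntCyl a b T u := W.u_int
  have hq := W.integrable_waveSrc n
  refine eqOn_Icc_of_ae_eq_Ioo hT
    (R.u_cont.continuousOn_slc (memL2_of_continuous (continuous_es a b n)))
    (prim_continuousOn hT (ContinuousOn.integrableOn_Ioo (prim_continuousOn hT hq _)) _) ?_
  refine ae_eq_prim_prim_of_weak hT (hu.coeff_integrable (continuous_es a b n)) hq ?_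
  intro χ hχ
  exact W.weak_u_mode hab h0 h0t n hχ

lemma IsWeakSol.ut_mode (hab : a < b) (hT : 0 < T)
    (W : IsWeakSol a b T f f' u0 u0t Θ0 u ut ux Θ Θx) (R : RegT a b T u ut ux Θ Θx)
    (h0 : IntegrableOn u0 (Ioo a b)) (h0t : IntegrableOn u0t (Ioo a b)) (n : ℕ) :
    EqOn (slc a b (es a b n) ut)
      (prim (∫ x in Ioo a b, u0t x * es a b n x) (waveSrc a b f' u Θ Θx n)) (Icc 0 T) := by
  have hu : IntCyl a b T u := W.u_int
  have hut : IntCyl a b T ut := W.ut_int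
  have hec : Continuous (es a b n) := continuous_es a b n
  have hq := W.integrable_waveSrc n
  have hpc := prim_continuousOn hT hq (∫ x in Ioo a b, u0t x * es a b n x)
  refine eqOn_Icc_of_ae_eq_Ioo hT
    (R.ut_cont.continuousOn_slc (memL2_of_continuous hec)) hpc ?_
  refine ae_eq_of_integral_test (hut.coeff_integrable hec)
    (ContinuousOn.integrableOn_Ioo hpc) ?_
  intro η h1 h2 h3
  have hη : TimeTest T η := timeTest_of_tsupport hT h1 h2 h3
  have hη0 : η 0 = 0 := image_eq_zero_of_notMem_tsupport fun h => lt_irrefl _ (h3 h).1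
  have ip := integral_prim_mul_deriv hT (ContinuousOn.integrableOn_Ioo hpc)
    (∫ x in Ioo a b, u0 x * es a b n x) hη
  rw [hη0, mul_zero, zero_sub] at ip
  obtain ⟨ψ, C, hψ, hs, hC, hl⟩ := exists_compactly_supported_approx hab n
  have hψc : ∀ j, Continuous (ψ j) := fun j => (hψ j).continuous
  have hC1 : ∀ j, ∀ x ∈ Ioo a b, |ψ j x| ≤ C := fun j x hx => (hC j x hx).1
  have hl1 : ∀ x ∈ Ioo a b, ∀ᶠ j in atTop, ψ j x = es a b n x :=
    fun x hx => (hl x hx).mono fun j h => h.1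
  have key : ∀ j, intOmT a b T (fun x t => u x t * (ψ j x * deriv η t))
      = - intOmT a b T (fun x t => ut x t * (ψ j x * η t)) := by
    intro j
    obtain ⟨K, k1, k2, k3⟩ := hs j
    have h := W.ut_weak (fun x t => ψ j x * η t)
      ⟨contDiff_uncurry_mul (hψ j) hη.smooth, ⟨K, k1, k2, fun x t hx => by rw [k3 x hx, zero_mul]⟩,
        ⟨tsupport η, h2, h3, fun x t ht => by
          rw [image_eq_zero_of_notMem_tsupport ht, mul_zero]⟩⟩
    rwa [pdt_mul] at h
  have e := tendsto_nhds_unique ((hu.tendsto_intOmT hψc hC1 hl1 hη.deriv.continuous).congr key)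
    (hut.tendsto_intOmT hψc hC1 hl1 hη.continuous).neg
  rw [hu.intOmT_mul hec hη.deriv.continuous, hut.intOmT_mul hec hη.continuous] at e
  have e2 : ∫ t in Ioo 0 T, (∫ x in Ioo a b, u x t * es a b n x) * deriv η t
      = ∫ t in Ioo 0 T, prim (∫ x in Ioo a b, u0 x * es a b n x)
      (prim (∫ x in Ioo a b, u0t x * es a b n x) (waveSrc a b f' u Θ Θx n)) t * deriv η t := by
    refine setIntegral_congr_fun measurableSet_Ioo fun t ht => ?_
    simp only [← W.u_mode hab hT R h0 h0t n (Ioo_subset_Icc_self ht), slc]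
  rw [e2, ip] at e
  simp only [slc]
  linarith

end

lemma MemL2.sqrt_sqOm {a b : ℝ} {g : ℝ → ℝ} (hg : MemL2 a b g) :
    √(sqOm a b g) = ‖hg.memLp.toLp g‖ := by
  rw [norm_eq_sqrt_real_inner, inner_toLp_eq hg.memLp hg.memLp]
  simp only [sqOm, sq]

lemma MemL2.abs_sqrt_sub_le {a b : ℝ} {g h : ℝ → ℝ} (hg : MemL2 a b g) (hh : MemL2 a b h) :
    |√(sqOm a b g) - √(sqOm a b h)| ≤ √(sqOm a b fun x => g x - h x) := by
  have e : (hg.sub hh).memLp.toLp _ = hg.memLp.toLp g - hh.memLp.toLp h :=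
    (MemLp.toLp_sub hg.memLp hh.memLp).symm ▸ rfl
  rw [hg.sqrt_sqOm, hh.sqrt_sqOm, (hg.sub hh).sqrt_sqOm, e]
  exact abs_norm_sub_norm_le _ _

lemma sqOm_nonneg (a b : ℝ) (g : ℝ → ℝ) : 0 ≤ sqOm a b g :=
  integral_nonneg fun _ => sq_nonneg _

lemma ContL2.continuousOn_sqOm {a b T : ℝ} {w : ℝ → ℝ → ℝ} (hw : ContL2 a b (Icc 0 T) w) :
    ContinuousOn (fun t => sqOm a b fun x => w x t) (Icc 0 T) := by
  have h : ContinuousOn (fun t => √(sqOm a b fun x => w x t)) (Icc 0 T) := by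
    intro t₀ ht₀
    have h1 := (hw.2 t₀ ht₀).sqrt
    rw [Real.sqrt_zero] at h1
    refine tendsto_iff_dist_tendsto_zero.2 ?_
    refine squeeze_zero' (Eventually.of_forall fun _ => dist_nonneg) ?_ h1
    filter_upwards [self_mem_nhdsWithin] with t ht
    rw [Real.dist_eq]
    exact (hw.1 t ht).abs_sqrt_sub_le (hw.1 t₀ ht₀)
  refine (h.pow 2).congr fun t _ => ?_
  exact (Real.sq_sqrt (sqOm_nonneg _ _ _)).symm

lemma MemL2.nrmL1_le {a b : ℝ} (hab : a < b) {g : ℝ → ℝ} (hg : MemL2 a b g) :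
    nrmL1 a b g ≤ √(sqOm a b g) * √(b - a) := by
  have h := abs_integral_mul_le hg.abs (memL2_of_continuous (continuous_const (y := (1 : ℝ))))
  have e : sqOm a b (fun _ => (1 : ℝ)) = b - a := by
    simp [sqOm, hab.le]
  have e' : sqOm a b (fun x => |g x|) = sqOm a b g := by simp [sqOm]
  rw [e, e'] at h
  simpa [nrmL1] using (le_abs_self _).trans h

lemma ContL2.continuousOn_nrmL1 {a b T : ℝ} (hab : a < b) {w : ℝ → ℝ → ℝ}
    (hw : ContL2 a b (Icc 0 T) w) :
    ContinuousOn (fun t => nrmL1 a b fun x => w x t) (Icc 0 T) := by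
  intro t₀ ht₀
  have h1 := (hw.2 t₀ ht₀).sqrt.mul_const √(b - a)
  rw [Real.sqrt_zero, zero_mul] at h1
  refine tendsto_iff_dist_tendsto_zero.2 ?_
  refine squeeze_zero' (Eventually.of_forall fun _ => dist_nonneg) ?_ h1
  filter_upwards [self_mem_nhdsWithin] with t ht
  have hs := (hw.1 t ht).sub (hw.1 t₀ ht₀)
  refine le_trans ?_ (hs.nrmL1_le hab)
  rw [Real.dist_eq, nrmL1, nrmL1,
    ← integral_sub (hw.1 t ht).abs.integrable (hw.1 t₀ ht₀).abs.integrable]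
  refine (abs_integral_le_integral_abs).trans ?_
  exact integral_mono ((hw.1 t ht).abs.sub (hw.1 t₀ ht₀).abs).integrable.abs hs.integrable.abs
    fun x => abs_abs_sub_abs_le_abs_sub _ _

/-- Fubini for null sets on the cylinder. -/
lemma ae_slice {a b T : ℝ} {p : ℝ → ℝ → Prop}
    (h : ∀ᵐ q ∂volume.restrict (Ioo a b ×ˢ Ioo 0 T), p q.1 q.2) :
    ∀ᵐ t ∂volume.restrict (Ioo 0 T), ∀ᵐ x ∂volume.restrict (Ioo a b), p x t := by
  rw [volume_restrict_prod] at h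
  exact Measure.ae_ae_of_ae_prod
    ((Measure.measurePreserving_swap.quasiMeasurePreserving).ae h)

lemma IntCyl.ae_memL2 {a b T : ℝ} {F : ℝ → ℝ → ℝ} (h1 : IntCyl a b T F)
    (h2 : IntCyl a b T fun x t => F x t ^ 2) :
    ∀ᵐ t ∂volume.restrict (Ioo 0 T), MemL2 a b fun x => F x t := by
  filter_upwards [h1.slice, h2.slice] with t s1 s2
  exact ⟨s1.aestronglyMeasurable, s2⟩

section

variable {a b T : ℝ} {f f' f'' : ℝ → ℝ} {u0 u0x u0t Θ0 : ℝ → ℝ} {u ut ux Θ Θx : ℝ → ℝ → ℝ}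

lemma IsWeakSol.ae_gradf_le (W : IsWeakSol a b T f f' u0 u0t Θ0 u ut ux Θ Θx) {M : ℝ}
    (hM : ∀ y ∈ Ici (0 : ℝ), |f' y| ≤ M) :
    ∀ᵐ p ∂volume.restrict (Ioo a b ×ˢ Ioo 0 T),
      |gradf f' Θ Θx p.1 p.2| ≤ M * |Θx p.1 p.2| := by
  filter_upwards [W.Θ_nonneg] with p hp
  rw [gradf, abs_mul]
  exact mul_le_mul_of_nonneg_right (hM _ hp) (abs_nonneg _)

lemma IsWeakSol.intCyl_gradf_sq (W : IsWeakSol a b T f f' u0 u0t Θ0 u ut ux Θ Θx)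
    (R : RegT a b T u ut ux Θ Θx) {M : ℝ} (hM : ∀ y ∈ Ici (0 : ℝ), |f' y| ≤ M) :
    IntCyl a b T (fun x t => gradf f' Θ Θx x t ^ 2) := by
  refine Integrable.mono' (R.Θx_sq_int.const_mul (M ^ 2))
    (W.g1_int.aestronglyMeasurable.pow 2) ?_
  filter_upwards [W.ae_gradf_le hM] with p hp
  rw [Real.norm_eq_abs, abs_pow, ← mul_pow, ← sq_abs (M * _)]
  refine pow_le_pow_left₀ (abs_nonneg _) (hp.trans ?_) 2
  rw [abs_mul]
  exact mul_le_mul_of_nonneg_right (le_abs_self _) (abs_nonneg _)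

lemma IsWeakSol.mode_energy (hab : a < b) (hT : 0 < T)
    (W : IsWeakSol a b T f f' u0 u0t Θ0 u ut ux Θ Θx) (R : RegT a b T u ut ux Θ Θx)
    (D : DataI a b u0 u0x u0t Θ0) (n : ℕ) {t : ℝ} (ht : t ∈ Ioo 0 T) :
    slc a b (es a b n) ut t ^ 2 ≤ (∫ x in Ioo a b, u0t x * es a b n x) ^ 2
      + (∫ x in Ioo a b, u0x x * ec a b (n + 1) x) ^ 2
      - 2 * ∫ s in Ioo 0 t, slc a b (es a b n) (gradf f' Θ Θx) s * slc a b (es a b n) ut s := by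
  have hec : Continuous (es a b n) := continuous_es a b n
  have hg : IntCyl a b T (gradf f' Θ Θx) := W.g1_int
  have hU := W.u_mode hab hT R D.u0_L2.integrable D.u0t_L2.integrable n
  have hV := W.ut_mode hab hT R D.u0_L2.integrable D.u0t_L2.integrable n
  set v := ∫ x in Ioo a b, u0t x * es a b n x
  set w := ∫ x in Ioo a b, u0 x * es a b n x
  set q := waveSrc a b f' u Θ Θx n
  have hq : IntegrableOn q (Ioo 0 T) := W.integrable_waveSrc n
  have htI : t ∈ Icc 0 T := Ioo_subset_Icc_self ht
  have hVc := prim_continuousOn hT hq v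
  have hVi : IntegrableOn (prim v q) (Ioo 0 T) := ContinuousOn.integrableOn_Ioo hVc
  have hUc := prim_continuousOn hT hVi w
  have e1 := prim_sq hq v ht.1 ht.2.le
  have e2 := prim_sq hVi w ht.1 ht.2.le
  rw [← hV htI] at e1
  rw [← hU htI] at e2
  have hsub : Ioo 0 t ⊆ Ioo 0 T := Ioo_subset_Ioo le_rfl ht.2.le
  have i1 : IntegrableOn (fun s => prim v q s * q s) (Ioo 0 t) := by
    have := (Integrable.mul_of_continuousOn hq hVc).mono_set hsub
    simpa only [mul_comm] using this
  have i2 : IntegrableOn (fun s => prim w (prim v q) s * prim v q s) (Ioo 0 t) :=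
    (ContinuousOn.integrableOn_Ioo (hUc.mul hVc)).mono_set hsub
  have e3 : (∫ s in Ioo 0 t, prim v q s * q s)
        + kap a b (n + 1) ^ 2 * ∫ s in Ioo 0 t, prim w (prim v q) s * prim v q s
      = -∫ s in Ioo 0 t, slc a b (es a b n) (gradf f' Θ Θx) s * slc a b (es a b n) ut s := by
    rw [← integral_const_mul, ← integral_add i1 (i2.const_mul _), ← integral_neg]
    refine setIntegral_congr_fun measurableSet_Ioo fun s hs => ?_
    have hsI := Ioo_subset_Icc_self (hsub hs)
    have hqs : q s = -(kap a b (n + 1) ^ 2 * slc a b (es a b n) u s)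
      - slc a b (es a b n) (gradf f' Θ Θx) s := rfl
    rw [← hU hsI, ← hV hsI, hqs]
    ring
  have e4 : (∫ x in Ioo a b, u0x x * ec a b (n + 1) x) ^ 2 = kap a b (n + 1) ^ 2 * w ^ 2 := by
    rw [← D.u0_W0.kap_mul_es n, mul_pow]
  rw [e4]
  nlinarith [sq_nonneg (kap a b (n + 1) * slc a b (es a b n) u t)]

lemma IsWeakSol.wave_energy (hab : a < b) (hT : 0 < T) (hf : HypF f f' f'')
    (W : IsWeakSol a b T f f' u0 u0t Θ0 u ut ux Θ Θx) (R : RegT a b T u ut ux Θ Θx)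
    (D : DataI a b u0 u0x u0t Θ0) {t : ℝ} (ht : t ∈ Ioo 0 T) :
    sqOm a b (fun x => ut x t) ≤ sqOm a b u0t + sqOm a b u0x
      - 2 * ∫ s in Ioo 0 t, ∫ x in Ioo a b, gradf f' Θ Θx x s * ut x s := by
  obtain ⟨M, hM'⟩ := hf.bdd
  have hM : ∀ y ∈ Ici (0 : ℝ), |f' y| ≤ M := fun y hy => (hM' y hy).1
  have hg : IntCyl a b T (gradf f' Θ Θx) := W.g1_int
  have hg2 := W.intCyl_gradf_sq R hM
  have hut : IntCyl a b T ut := W.ut_int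
  have hsub : Ioo 0 t ⊆ Ioo 0 T := Ioo_subset_Ioo le_rfl ht.2.le
  have hle : volume.restrict (Ioo 0 t) ≤ volume.restrict (Ioo 0 T) :=
    Measure.restrict_mono hsub le_rfl
  have hgm := ae_mono hle (hg.ae_memL2 hg2)
  have hs1 : HasSum (fun n => slc a b (es a b n) ut t ^ 2) (sqOm a b fun x => ut x t) := by
    have hm := R.ut_cont.1 t (Ioo_subset_Icc_self ht)
    have := parseval_es hab hm hm
    simpa only [slc, sqOm, sq] using this
  have ip : ∀ n, IntegrableOn (fun s => slc a b (es a b n) (gradf f' Θ Θx) s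
      * slc a b (es a b n) ut s) (Ioo 0 t) := fun n =>
    (Integrable.mul_of_continuousOn (hg.coeff_integrable (continuous_es a b n))
      (R.ut_cont.continuousOn_slc (memL2_of_continuous (continuous_es a b n)))).mono_set hsub
  have l2 : Tendsto (fun N => ∫ s in Ioo 0 t, ∑ n ∈ Finset.range N,
      slc a b (es a b n) (gradf f' Θ Θx) s * slc a b (es a b n) ut s) atTop
      (nhds (∫ s in Ioo 0 t, ∫ x in Ioo a b, gradf f' Θ Θx x s * ut x s)) := by
    refine tendsto_integral_of_dominated_convergence
      (fun s => sqOm a b (fun x => gradf f' Θ Θx x s) + sqOm a b (fun x => ut x s))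
      (fun N => (integrable_finsetSum _ fun n _ => ip n).aestronglyMeasurable)
      ((hg2.integral_slice.mono_set hsub).add
        ((ContinuousOn.integrableOn_Ioo R.ut_cont.continuousOn_sqOm).mono_set hsub)) ?_ ?_
    · intro N
      filter_upwards [hgm, ae_restrict_mem measurableSet_Ioo] with s h1 hs
      have h2 := R.ut_cont.1 s (Ioo_subset_Icc_self (hsub hs))
      have h3 := (orthoSeq_es hab).sum_abs_mul_le h1 h2 (Finset.range N)
      rw [Real.norm_eq_abs]
      refine (Finset.abs_sum_le_sum_abs _ _).trans ?_
      simp only [abs_mul]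
      refine h3.trans ?_
      have r1 := Real.sq_sqrt (sqOm_nonneg a b fun x => gradf f' Θ Θx x s)
      have r2 := Real.sq_sqrt (sqOm_nonneg a b fun x => ut x s)
      nlinarith [sq_nonneg (√(sqOm a b fun x => gradf f' Θ Θx x s) - √(sqOm a b fun x => ut x s)),
        sq_nonneg (√(sqOm a b fun x => gradf f' Θ Θx x s)),
        sq_nonneg (√(sqOm a b fun x => ut x s))]
    · filter_upwards [hgm, ae_restrict_mem measurableSet_Ioo] with s h1 hs
      have h2 := R.ut_cont.1 s (Ioo_subset_Icc_self (hsub hs))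
      exact (parseval_es hab h1 h2).tendsto_sum_nat
  refine le_of_tendsto_of_tendsto' hs1.tendsto_sum_nat
    (tendsto_const_nhds.sub (l2.const_mul 2)) fun N => ?_
  rw [integral_finsetSum _ fun n _ => ip n, Finset.mul_sum]
  have hb := Finset.sum_le_sum fun n (_ : n ∈ Finset.range N) => W.mode_energy hab hT R D n ht
  rw [Finset.sum_sub_distrib, Finset.sum_add_distrib] at hb
  have b1 := (orthoSeq_es hab).bessel D.u0t_L2 (Finset.range N)
  have b2 := (orthoSeq_ec hab).succ.bessel D.u0x_L2 (Finset.range N)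
  linarith

lemma IsWeakSol.heat_mass (hab : a < b) (hT : 0 < T)
    (W : IsWeakSol a b T f f' u0 u0t Θ0 u ut ux Θ Θx) (R : RegT a b T u ut ux Θ Θx)
    {t : ℝ} (ht : t ∈ Icc 0 T) :
    nrmL1 a b (fun x => Θ x t) = (∫ x in Ioo a b, Θ0 x)
      + ∫ s in Ioo 0 t, ∫ x in Ioo a b, gradf f' Θ Θx x s * ut x s := by
  have hΘ : IntCyl a b T Θ := W.Θ_int
  have hg : IntCyl a b T (fun x t => gradf f' Θ Θx x t * ut x t) := W.g2_int
  have hq := hg.integral_slice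
  have h1 : Continuous fun _ : ℝ => (1 : ℝ) := continuous_const
  have hm : (fun t => ∫ x in Ioo a b, Θ x t) =ᵐ[volume.restrict (Ioo 0 T)]
      prim (∫ x in Ioo a b, Θ0 x) (fun s => ∫ x in Ioo a b, gradf f' Θ Θx x s * ut x s) := by
    refine ae_eq_prim_of_weak hT hΘ.integral_slice hq fun χ hχ => ?_
    have h := W.weak_Θ _ (hχ.testT (ψ := fun _ => 1) contDiff_const)
    rw [pdt_mul, pdx_mul] at h
    have e1 := hΘ.intOmT_mul h1 hχ.deriv.continuous
    have e2 := hg.intOmT_mul h1 hχ.continuous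
    simp only [mul_one, one_mul, deriv_const', zero_mul, mul_zero, intOm,
      integral_mul_const] at h e1 e2
    rw [e1] at h
    rw [h]
    simp only [gradf] at e2 ⊢
    rw [← e2]
    simp [intOmT]
  have hc : EqOn (fun t => nrmL1 a b fun x => Θ x t) (prim (∫ x in Ioo a b, Θ0 x)
      (fun s => ∫ x in Ioo a b, gradf f' Θ Θx x s * ut x s)) (Icc 0 T) := by
    refine eqOn_Icc_of_ae_eq_Ioo hT (R.Θ_cont.continuousOn_nrmL1 hab)
      (prim_continuousOn hT hq _) (EventuallyEq.trans ?_ hm)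
    filter_upwards [ae_slice (p := fun x t => 0 ≤ Θ x t) W.Θ_nonneg] with s hs
    refine integral_congr_ae ?_
    filter_upwards [hs] with x hx
    exact abs_of_nonneg hx
  rw [integral_Ioo_eq_interval ht.1]
  exact hc ht

lemma IsWeakSol.energy (hab : a < b) (hT : 0 < T) (hf : HypF f f' f'')
    (W : IsWeakSol a b T f f' u0 u0t Θ0 u ut ux Θ Θx) (R : RegT a b T u ut ux Θ Θx)
    (D : DataI a b u0 u0x u0t Θ0) {t : ℝ} (ht : t ∈ Ioo 0 T) :
    sqOm a b (fun x => ut x t) + 2 * nrmL1 a b (fun x => Θ x t)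
      ≤ sqOm a b u0t + sqOm a b u0x + 2 * nrmL1 a b Θ0 := by
  have h1 := W.wave_energy hab hT hf R D ht
  have h2 := W.heat_mass hab hT R (Ioo_subset_Icc_self ht)
  have h3 : ∫ x in Ioo a b, Θ0 x ≤ nrmL1 a b Θ0 :=
    integral_mono D.Θ0_L2.integrable D.Θ0_L2.integrable.abs fun x => le_abs_self _
  linarith

end

lemma WeakDerivI.kap_mul_ec {a b : ℝ} (hab : a < b) {g g' : ℝ → ℝ} (hg : WeakDerivI a b g g')
    (h1 : IntegrableOn g (Ioo a b)) (h2 : IntegrableOn g' (Ioo a b)) (n : ℕ) :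
    kap a b (n + 1) * ∫ x in Ioo a b, g x * ec a b (n + 1) x
      = -∫ x in Ioo a b, g' x * es a b n x := by
  obtain ⟨ψ, C, hψ, hs, hC, hl⟩ := exists_compactly_supported_approx hab n
  have key : ∀ j, ∫ x in Ioo a b, g x * deriv (ψ j) x = -∫ x in Ioo a b, g' x * ψ j x := by
    intro j
    obtain ⟨K, k1, k2, k3⟩ := hs j
    refine hg (ψ j) (hψ j) ((closure_minimal ?_ k1.isClosed).trans k2)
    intro x hx
    by_contra h
    exact hx (k3 x h)
  have l1 := tendsto_intOm_mul h1 (fun j => (hψ j).continuous_deriv (by simp))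
    (fun j x hx => (hC j x hx).2) (fun x hx => (hl x hx).mono fun j h => h.2)
  have l2 := (tendsto_intOm_mul h2 (fun j => (hψ j).continuous)
    (fun j x hx => (hC j x hx).1) (fun x hx => (hl x hx).mono fun j h => h.1)).neg
  rw [← tendsto_nhds_unique (l1.congr key) l2, deriv_es, ← integral_const_mul]
  refine integral_congr_ae (Eventually.of_forall fun x => ?_)
  simp only
  ring

lemma bet_pos {a b : ℝ} (hab : a < b) : 0 < bet a b :=
  Real.sqrt_pos.2 (div_pos two_pos (sub_pos.2 hab))

lemma abs_integral_mul_ec_le {a b : ℝ} (hab : a < b) {g : ℝ → ℝ} (hg : IntegrableOn g (Ioo a b))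
    (n : ℕ) : |∫ x in Ioo a b, g x * ec a b n x| ≤ bet a b * nrmL1 a b g := by
  rw [nrmL1, ← integral_const_mul]
  refine abs_integral_le_integral_abs.trans ?_
  refine integral_mono (integrableOn_mul_bdd hg (continuous_ec a b n)).abs
    (hg.abs.const_mul _) fun x => ?_
  simp only [abs_mul]
  rw [mul_comm]
  exact mul_le_mul_of_nonneg_right (abs_ec_le hab n x) (abs_nonneg _)

lemma summable_inv_kap_sq (a b : ℝ) :
    Summable fun n : ℕ => (kap a b (n + 1))⁻¹ ^ 2 := by
  have h := ((summable_nat_add_iff 1).2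
    (Real.summable_nat_pow_inv.2 one_lt_two)).mul_left (((b - a) / Real.pi) ^ 2)
  refine h.congr fun n => ?_
  rw [kap, inv_div, ← inv_pow, ← mul_pow]
  congr 1
  push_cast
  rw [div_mul_eq_mul_div, ← div_eq_mul_inv, div_div]

/-- The cosine coefficients of a function are absolutely summable, and the sum is controlled by
the `L¹` norm plus a small multiple of the `L²` norm of the derivative. -/
lemma exists_sum_abs_ec_le {a b : ℝ} (hab : a < b) {δ : ℝ} (hδ : 0 < δ) :
    ∃ C : ℝ, 0 ≤ C ∧ ∀ g g' : ℝ → ℝ, IntegrableOn g (Ioo a b) → MemL2 a b g' →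
      WeakDerivI a b g g' → ∀ N, ∑ n ∈ Finset.range N, |∫ x in Ioo a b, g x * ec a b n x|
        ≤ C * nrmL1 a b g + δ * √(sqOm a b g') := by
  obtain ⟨s, hs⟩ := summable_iff_vanishing_norm.1 (summable_inv_kap_sq a b) (δ ^ 2) (by positivity)
  refine ⟨(s.card + 1) * bet a b, mul_nonneg (by positivity) (bet_pos hab).le, ?_⟩
  intro g g' hg hg' hw N
  set Y := bet a b * nrmL1 a b g with hY
  have hn1 : 0 ≤ nrmL1 a b g := integral_nonneg fun _ => abs_nonneg _
  have hY0 : 0 ≤ Y := mul_nonneg (bet_pos hab).le hn1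
  let y : ℕ → ℝ := fun n => if n ∈ s then 0 else (kap a b (n + 1))⁻¹
  let S : ℕ → ℝ := fun n => ∫ x in Ioo a b, g' x * es a b n x
  have hterm : ∀ n, |∫ x in Ioo a b, g x * ec a b (n + 1) x|
      ≤ (if n ∈ s then Y else 0) + |y n| * |S n| := by
    intro n
    by_cases h : n ∈ s
    · simpa [h, y] using abs_integral_mul_ec_le hab hg (n + 1)
    · have hk := kap_pos hab n
      have e := hw.kap_mul_ec hab hg hg'.integrable n
      simp only [h, y, if_false, zero_add]
      rw [← abs_mul]
      refine le_of_eq ?_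
      rw [← abs_neg (_ * _)]
      congr 1
      simp only [S]
      rw [← mul_neg, ← e, inv_mul_cancel_left₀ hk.ne']
  have hy : ∑ n ∈ Finset.range N, y n ^ 2 ≤ δ ^ 2 := by
    have h1 := hs (Finset.range N \ s) Finset.sdiff_disjoint
    refine le_trans (le_of_eq ?_) ((le_abs_self _).trans h1.le)
    rw [Finset.sdiff_eq_filter, Finset.sum_filter]
    refine Finset.sum_congr rfl fun n _ => ?_
    by_cases h : n ∈ s <;> simp [h, y]
  have h2 := abs_sum_mul_le_sqrt (Finset.range N) y S hy
    ((orthoSeq_es hab).bessel hg' (Finset.range N))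
  rw [Real.sqrt_sq hδ.le] at h2
  have h3 : ∑ n ∈ Finset.range N, (if n ∈ s then Y else 0) ≤ s.card * Y := by
    rw [← Finset.sum_filter, Finset.sum_const, nsmul_eq_mul]
    refine mul_le_mul_of_nonneg_right ?_ hY0
    exact_mod_cast Finset.card_le_card fun x hx => (Finset.mem_filter.1 hx).2
  calc ∑ n ∈ Finset.range N, |∫ x in Ioo a b, g x * ec a b n x|
      ≤ ∑ n ∈ Finset.range (N + 1), |∫ x in Ioo a b, g x * ec a b n x| :=
        Finset.sum_le_sum_of_subset_of_nonneg (Finset.range_mono N.le_succ)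
          fun _ _ _ => abs_nonneg _
    _ = (∑ n ∈ Finset.range N, |∫ x in Ioo a b, g x * ec a b (n + 1) x|)
          + |∫ x in Ioo a b, g x * ec a b 0 x| := Finset.sum_range_succ' _ _
    _ ≤ ((s.card * Y) + δ * √(sqOm a b g')) + Y := by
        refine add_le_add ?_ (abs_integral_mul_ec_le hab hg 0)
        refine (Finset.sum_le_sum fun n _ => hterm n).trans ?_
        rw [Finset.sum_add_distrib]
        exact add_le_add h3 h2
    _ = (s.card + 1) * bet a b * nrmL1 a b g + δ * √(sqOm a b g') := by rw [hY]; ring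

lemma abs_le_of_sum_abs_ec_le {a b : ℝ} (hab : a < b) {g : ℝ → ℝ} (hg : IntegrableOn g (Ioo a b))
    {X : ℝ} (hX : ∀ N, ∑ n ∈ Finset.range N, |∫ x in Ioo a b, g x * ec a b n x| ≤ X) :
    ∀ᵐ x ∂volume.restrict (Ioo a b), |g x| ≤ bet a b * X := by
  let c : ℕ → ℝ := fun n => ∫ x in Ioo a b, g x * ec a b n x
  have hc : Summable fun n => |c n| := summable_of_sum_range_le (fun _ => abs_nonneg _) hX
  have hcX : ∑' n, |c n| ≤ X := hc.tsum_le_of_sum_range_le hX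
  have hb : ∀ n x, ‖c n * ec a b n x‖ ≤ |c n| * bet a b := fun n x => by
    rw [Real.norm_eq_abs, abs_mul]
    exact mul_le_mul_of_nonneg_left (abs_ec_le hab n x) (abs_nonneg _)
  have hcb := hc.mul_right (bet a b)
  let F : ℝ → ℝ := fun x => ∑' n, c n * ec a b n x
  have hF : Continuous F :=
    continuous_tsum (fun n => continuous_const.mul (continuous_ec a b n)) hcb hb
  have hFi : IntegrableOn F (Ioo a b) := integrableOn_of_continuous hF
  have hFX : ∀ x, |F x| ≤ bet a b * X := by
    intro x
    refine (tsum_of_norm_bounded hcb.hasSum fun n => hb n x).trans ?_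
    rw [tsum_mul_right, mul_comm]
    exact mul_le_mul_of_nonneg_left hcX (bet_nonneg a b)
  have hFc : ∀ m, ∫ x in Ioo a b, F x * ec a b m x = c m := by
    intro m
    have hi : ∀ n, Integrable (fun x => c n * ec a b n x * ec a b m x)
        (volume.restrict (Ioo a b)) := fun n =>
      integrableOn_of_continuous
        ((continuous_const.mul (continuous_ec a b n)).mul (continuous_ec a b m))
    have hs : Summable fun n => ∫ x in Ioo a b, ‖c n * ec a b n x * ec a b m x‖ := by
      refine Summable.of_nonneg_of_le (fun n => integral_nonneg fun _ => norm_nonneg _)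
        (fun n => ?_) (hcb.mul_right (bet a b * (b - a)))
      refine (integral_mono (hi n).norm (integrable_const (|c n| * bet a b * bet a b))
        fun x => ?_).trans ?_
      · simp only [norm_mul]
        have := hb n x
        rw [norm_mul] at this
        exact mul_le_mul this (abs_ec_le hab m x) (abs_nonneg _)
          (mul_nonneg (abs_nonneg _) (bet_nonneg a b))
      · rw [integral_const, smul_eq_mul]
        simp [hab.le]
        apply le_of_eq
        ring
    have h := (hasSum_integral_of_summable_integral_norm hi hs).tsum_eq
    have e : ∀ n, ∫ x in Ioo a b, c n * ec a b n x * ec a b m x = if n = m then c m else 0 := by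
      intro n
      simp only [mul_assoc]
      rw [integral_const_mul, integral_ec_mul_ec hab]
      split_ifs with h
      · rw [h, mul_one]
      · rw [mul_zero]
    simp only [e, tsum_mul_right] at h
    rw [tsum_ite_eq] at h
    exact h.symm
  have h0 := ae_zero_of_integral_ec hab (hg.sub hFi) fun m => by
    simp only [Pi.sub_apply, sub_mul]
    rw [integral_sub (integrableOn_mul_bdd hg (continuous_ec a b m))
      (integrableOn_mul_bdd hFi (continuous_ec a b m)), hFc m, sub_self]
  filter_upwards [h0] with x hx
  have : g x = F x := sub_eq_zero.1 hx
  rw [this]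
  exact hFX x

lemma HypF.abs_le {f f' f'' : ℝ → ℝ} (hf : HypF f f' f'') {M : ℝ}
    (hM : ∀ y ∈ Ici (0 : ℝ), |f' y| ≤ M) {y : ℝ} (hy : 0 ≤ y) : |f y| ≤ M * y := by
  have h := Convex.norm_image_sub_le_of_norm_hasDerivWithin_le hf.hasDeriv₁ hM (convex_Ici 0)
    (mem_Ici.2 le_rfl) (mem_Ici.2 hy)
  simpa [hf.zero, abs_of_nonneg hy] using h

section

variable {a b T : ℝ} {f f' f'' : ℝ → ℝ} {u0 u0x u0t Θ0 : ℝ → ℝ} {u ut ux Θ Θx : ℝ → ℝ → ℝ}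

/-- The source of the `(n+1)`-st mode of the heat equation. -/
def heatSrc (a b : ℝ) (f f' : ℝ → ℝ) (ut Θ Θx : ℝ → ℝ → ℝ) (n : ℕ) (t : ℝ) : ℝ :=
  kap a b (n + 1) * slc a b (es a b n) Θx t
    + slc a b (ec a b (n + 1)) (fun x t => gradf f' Θ Θx x t * ut x t) t
    - kap a b (n + 1) * slc a b (es a b n) (fun x t => f (Θ x t) * ut x t) t

lemma IsWeakSol.integrable_heatSrc (W : IsWeakSol a b T f f' u0 u0t Θ0 u ut ux Θ Θx) (n : ℕ) :
    IntegrableOn (heatSrc a b f f' ut Θ Θx n) (Ioo 0 T) := by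
  have h1 : IntCyl a b T Θx := W.Θx_int
  have h2 : IntCyl a b T (fun x t => gradf f' Θ Θx x t * ut x t) := W.g2_int
  have h3 : IntCyl a b T (fun x t => f (Θ x t) * ut x t) := W.g3_int
  exact (((h1.coeff_integrable (continuous_es a b n)).const_mul _).add
    (h2.coeff_integrable (continuous_ec a b (n + 1)))).sub
    ((h3.coeff_integrable (continuous_es a b n)).const_mul _)

lemma IsWeakSol.Θ_mode (hT : 0 < T)
    (W : IsWeakSol a b T f f' u0 u0t Θ0 u ut ux Θ Θx) (R : RegT a b T u ut ux Θ Θx) (n : ℕ) :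
    EqOn (slc a b (ec a b (n + 1)) Θ)
      (prim (∫ x in Ioo a b, Θ0 x * ec a b (n + 1) x) (heatSrc a b f f' ut Θ Θx n))
      (Icc 0 T) := by
  have h0 : IntCyl a b T Θ := W.Θ_int
  have h1 : IntCyl a b T Θx := W.Θx_int
  have h2 : IntCyl a b T (fun x t => gradf f' Θ Θx x t * ut x t) := W.g2_int
  have h3 : IntCyl a b T (fun x t => f (Θ x t) * ut x t) := W.g3_int
  have hes : Continuous (es a b n) := continuous_es a b n
  have hec : Continuous (ec a b (n + 1)) := continuous_ec a b (n + 1)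
  have hq := W.integrable_heatSrc n
  refine eqOn_Icc_of_ae_eq_Ioo hT
    (R.Θ_cont.continuousOn_slc (memL2_of_continuous hec)) (prim_continuousOn hT hq _) ?_
  refine ae_eq_prim_of_weak hT (h0.coeff_integrable hec) hq fun χ hχ => ?_
  have h := W.weak_Θ _ (hχ.testT (contDiff_ec a b (n + 1)))
  rw [pdt_mul, pdx_mul, deriv_ec] at h
  have hkes : Continuous fun x => -(kap a b (n + 1) * es a b n x) := by fun_prop
  have e0 := h0.intOmT_mul hec hχ.deriv.continuous
  have e1 := h1.intOmT_mul hkes hχ.continuous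
  have e2 := h2.intOmT_mul hec hχ.continuous
  have e3 := h3.intOmT_mul hkes hχ.continuous
  have c : ∀ (F : ℝ → ℝ → ℝ) t, ∫ x in Ioo a b, F x t * -(kap a b (n + 1) * es a b n x)
      = -(kap a b (n + 1) * slc a b (es a b n) F t) := by
    intro F t
    rw [slc, ← integral_const_mul, ← integral_neg]
    refine integral_congr_ae (Eventually.of_forall fun x => ?_)
    simp only
    ring
  simp only [c Θx] at e1
  have c3 := c fun x t => f (Θ x t) * ut x t
  simp only [c3] at e3
  rw [e0, e1, e3] at h
  have e2' : intOmT a b T (fun x t => f' (Θ x t) * Θx x t * ut x t * (ec a b (n + 1) x * χ t))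
      = ∫ t in Ioo 0 T,
        slc a b (ec a b (n + 1)) (fun x t => gradf f' Θ Θx x t * ut x t) t * χ t := e2
  rw [e2'] at h
  simp only [intOm, ← mul_assoc, integral_mul_const] at h
  have hi : ∀ {p : ℝ → ℝ}, IntegrableOn p (Ioo 0 T) → IntegrableOn (fun t => p t * χ t) (Ioo 0 T) :=
    fun hp => Integrable.mul_of_continuousOn hp hχ.continuous.continuousOn
  have i1 := hi ((h1.coeff_integrable hes).const_mul (kap a b (n + 1))).neg
  have i2 := hi (h2.coeff_integrable hec)
  have i3 := hi ((h3.coeff_integrable hes).const_mul (kap a b (n + 1))).neg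
  refine h.trans ?_
  rw [← integral_neg]
  refine ((congrArg₂ _ (integral_add i1.neg i2).symm rfl).trans
    (integral_add (i1.neg.add i2) i3).symm).trans ?_
  refine integral_congr_ae (Eventually.of_forall fun t => ?_)
  simp only [heatSrc, Pi.add_apply, Pi.neg_apply, slc]
  ring

lemma IsWeakSol.heat_mode_energy (hab : a < b) (hT : 0 < T)
    (W : IsWeakSol a b T f f' u0 u0t Θ0 u ut ux Θ Θx) (R : RegT a b T u ut ux Θ Θx) (n : ℕ) :
    IntegrableOn (fun t => slc a b (es a b n) Θx t ^ 2) (Ioo 0 T) ∧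
    IntegrableOn (fun t => |slc a b (ec a b (n + 1)) (fun x t => gradf f' Θ Θx x t * ut x t) t|
        * |slc a b (ec a b (n + 1)) Θ t|
      + |slc a b (es a b n) Θx t| * |slc a b (es a b n) (fun x t => f (Θ x t) * ut x t) t|)
      (Ioo 0 T) ∧
    2 * ∫ t in Ioo 0 T, slc a b (es a b n) Θx t ^ 2
      ≤ (∫ x in Ioo a b, Θ0 x * ec a b (n + 1) x) ^ 2
        + 2 * ∫ t in Ioo 0 T,
          (|slc a b (ec a b (n + 1)) (fun x t => gradf f' Θ Θx x t * ut x t) t|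
            * |slc a b (ec a b (n + 1)) Θ t|
          + |slc a b (es a b n) Θx t|
            * |slc a b (es a b n) (fun x t => f (Θ x t) * ut x t) t|) := by
  have h0 : IntCyl a b T Θ := W.Θ_int
  have h1 : IntCyl a b T Θx := W.Θx_int
  have h2 : IntCyl a b T (fun x t => gradf f' Θ Θx x t * ut x t) := W.g2_int
  have h3 : IntCyl a b T (fun x t => f (Θ x t) * ut x t) := W.g3_int
  have hes : Continuous (es a b n) := continuous_es a b n
  have hec : Continuous (ec a b (n + 1)) := continuous_ec a b (n + 1)
  have hq := W.integrable_heatSrc n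
  have hC := W.Θ_mode hT R n
  have hCc := R.Θ_cont.continuousOn_slc (memL2_of_continuous hec)
  have hS : ∀ᵐ t ∂volume.restrict (Ioo 0 T),
      kap a b (n + 1) * slc a b (ec a b (n + 1)) Θ t = -slc a b (es a b n) Θx t := by
    filter_upwards [W.Θ_W, h0.slice, h1.slice] with t w s0 s1
    exact w.kap_mul_ec hab s0 s1 n
  have hA := h2.coeff_integrable hec
  have hB := h3.coeff_integrable hes
  have hSi := h1.coeff_integrable hes
  set C := slc a b (ec a b (n + 1)) Θ
  set S := slc a b (es a b n) Θx
  set A := slc a b (ec a b (n + 1)) (fun x t => gradf f' Θ Θx x t * ut x t)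
  set B := slc a b (es a b n) (fun x t => f (Θ x t) * ut x t)
  have i1 : IntegrableOn (fun t => S t ^ 2) (Ioo 0 T) := by
    refine (Integrable.mul_of_continuousOn hSi (hCc.const_mul (-kap a b (n + 1)))).congr ?_
    filter_upwards [hS] with t ht
    rw [neg_mul, ht, neg_neg, sq]
    rfl
  have i2 : IntegrableOn (fun t => A t * C t) (Ioo 0 T) := Integrable.mul_of_continuousOn hA hCc
  have i3 : IntegrableOn (fun t => S t * B t) (Ioo 0 T) := by
    refine (Integrable.mul_of_continuousOn hB (hCc.const_mul (-kap a b (n + 1)))).congr ?_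
    filter_upwards [hS] with t ht
    rw [neg_mul, ht, neg_neg, mul_comm]
    rfl
  have i4 : IntegrableOn (fun t => |A t| * |C t| + |S t| * |B t|) (Ioo 0 T) := by
    have := i2.abs.add i3.abs
    simp only [abs_mul] at this
    exact this
  refine ⟨i1, i4, ?_⟩
  have e := prim_sq hq (∫ x in Ioo a b, Θ0 x * ec a b (n + 1) x) hT le_rfl
  rw [← hC ⟨hT.le, le_rfl⟩] at e
  have e2 : (∫ s in Ioo 0 T, prim (∫ x in Ioo a b, Θ0 x * ec a b (n + 1) x)
        (heatSrc a b f f' ut Θ Θx n) s * heatSrc a b f f' ut Θ Θx n s)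
      ≤ ∫ t in Ioo 0 T, ((|A t| * |C t| + |S t| * |B t|) - S t ^ 2) := by
    refine integral_mono_ae ?_ (i4.sub i1) ?_
    · have := Integrable.mul_of_continuousOn hq (prim_continuousOn hT hq
        (∫ x in Ioo a b, Θ0 x * ec a b (n + 1) x))
      simpa only [IntegrableOn, mul_comm] using this
    · filter_upwards [hS, ae_restrict_mem measurableSet_Ioo] with t ht htI
      rw [← hC (Ioo_subset_Icc_self htI)]
      have hqt : heatSrc a b f f' ut Θ Θx n t
        = kap a b (n + 1) * S t + A t - kap a b (n + 1) * B t := rfl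
      rw [hqt]
      have j1 : A t * C t ≤ |A t| * |C t| := (le_abs_self _).trans (abs_mul _ _).le
      have j2 : S t * B t ≤ |S t| * |B t| := (le_abs_self _).trans (abs_mul _ _).le
      have j3 : C t * (kap a b (n + 1) * S t + A t - kap a b (n + 1) * B t)
          = (kap a b (n + 1) * C t) * S t + A t * C t - (kap a b (n + 1) * C t) * B t := by ring
      change C t * _ ≤ _
      rw [j3, ht]
      nlinarith
  rw [integral_sub i4 i1] at e2
  nlinarith [sq_nonneg (C T)]

/-- Pointwise-in-time bound of the source terms of the heat equation. -/
lemma sum_heat_source_le (hab : a < b) (hf : HypF f f' f'') {M : ℝ}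
    (hM : ∀ y ∈ Ici (0 : ℝ), |f' y| ≤ M) {X D : ℝ} {θ θx h v : ℝ → ℝ}
    (hθ : IntegrableOn θ (Ioo a b)) (hθ0 : ∀ᵐ x ∂volume.restrict (Ioo a b), 0 ≤ θ x)
    (hθx : MemL2 a b θx) (hh : MemL2 a b h)
    (hhθ : ∀ᵐ x ∂volume.restrict (Ioo a b), |h x| ≤ M * |θx x|)
    (hv : MemL2 a b v) (hvD : √(sqOm a b v) ≤ D)
    (hfv : IntegrableOn (fun x => f (θ x) * v x) (Ioo a b))
    (hX : ∀ N, ∑ n ∈ Finset.range N, |∫ x in Ioo a b, θ x * ec a b n x| ≤ X) (N : ℕ) :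
    ∑ n ∈ Finset.range N, (|∫ x in Ioo a b, h x * v x * ec a b (n + 1) x|
        * |∫ x in Ioo a b, θ x * ec a b (n + 1) x|
      + |∫ x in Ioo a b, θx x * es a b n x| * |∫ x in Ioo a b, f (θ x) * v x * es a b n x|)
      ≤ 2 * bet a b * M * D * √(sqOm a b θx) * X := by
  have hM0 : 0 ≤ M := (abs_nonneg _).trans (hM 0 (mem_Ici.2 le_rfl))
  have hb := bet_nonneg a b
  have hX0 : 0 ≤ X := by simpa using hX 0
  have hD0 : 0 ≤ D := (Real.sqrt_nonneg _).trans hvD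
  have hsup := abs_le_of_sum_abs_ec_le hab hθ hX
  have hh_le : √(sqOm a b h) ≤ M * √(sqOm a b θx) := by
    rw [← Real.sqrt_sq hM0, ← Real.sqrt_mul (sq_nonneg M)]
    refine Real.sqrt_le_sqrt ?_
    rw [sqOm, sqOm, ← integral_const_mul]
    refine integral_mono_ae hh.2 (hθx.2.const_mul _) ?_
    filter_upwards [hhθ] with x hx
    rw [← sq_abs (h x), ← sq_abs (θx x), ← mul_pow]
    exact pow_le_pow_left₀ (abs_nonneg _) hx 2
  have hA : ∀ n, |∫ x in Ioo a b, h x * v x * ec a b (n + 1) x|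
      ≤ bet a b * M * D * √(sqOm a b θx) := by
    intro n
    refine (abs_integral_mul_ec_le hab (hh.integrable_mul hv) (n + 1)).trans ?_
    have h1 : nrmL1 a b (fun x => h x * v x) ≤ √(sqOm a b h) * √(sqOm a b v) := by
      have := (le_abs_self _).trans (abs_integral_mul_le hh.abs hv.abs)
      simpa only [nrmL1, abs_mul, sqOm, sq_abs] using this
    have h2 : √(sqOm a b h) * √(sqOm a b v) ≤ M * √(sqOm a b θx) * D :=
      mul_le_mul hh_le hvD (Real.sqrt_nonneg _) (mul_nonneg hM0 (Real.sqrt_nonneg _))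
    calc bet a b * nrmL1 a b (fun x => h x * v x) ≤ bet a b * (M * √(sqOm a b θx) * D) :=
          mul_le_mul_of_nonneg_left (h1.trans h2) hb
      _ = _ := by ring
  have hpt : ∀ᵐ x ∂volume.restrict (Ioo a b), (f (θ x) * v x) ^ 2
      ≤ (M * (bet a b * X)) ^ 2 * v x ^ 2 := by
    filter_upwards [hθ0, hsup] with x h0 h1
    rw [mul_pow, ← sq_abs (f (θ x))]
    refine mul_le_mul_of_nonneg_right (pow_le_pow_left₀ (abs_nonneg _) ?_ 2) (sq_nonneg _)
    exact (hf.abs_le hM h0).trans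
      (mul_le_mul_of_nonneg_left ((le_abs_self _).trans h1) hM0)
  have hfvm : MemL2 a b (fun x => f (θ x) * v x) := by
    refine ⟨hfv.aestronglyMeasurable, Integrable.mono' (hv.2.const_mul ((M * (bet a b * X)) ^ 2))
      (hfv.aestronglyMeasurable.pow 2) ?_⟩
    filter_upwards [hpt] with x hx
    rw [Real.norm_eq_abs, abs_of_nonneg (sq_nonneg _)]
    exact hx
  have hB : √(sqOm a b fun x => f (θ x) * v x) ≤ M * (bet a b * X) * D := by
    refine le_trans ?_ (mul_le_mul_of_nonneg_left hvD (mul_nonneg hM0 (mul_nonneg hb hX0)))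
    rw [← Real.sqrt_sq (mul_nonneg hM0 (mul_nonneg hb hX0)), ← Real.sqrt_mul (sq_nonneg _)]
    refine Real.sqrt_le_sqrt ?_
    rw [sqOm, sqOm, ← integral_const_mul]
    exact integral_mono_ae hfvm.2 (hv.2.const_mul _) hpt
  rw [Finset.sum_add_distrib]
  have s1 : ∑ n ∈ Finset.range N, |∫ x in Ioo a b, h x * v x * ec a b (n + 1) x|
        * |∫ x in Ioo a b, θ x * ec a b (n + 1) x|
      ≤ bet a b * M * D * √(sqOm a b θx) * X := by
    refine (Finset.sum_le_sum fun n _ =>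
      mul_le_mul_of_nonneg_right (hA n) (abs_nonneg _)).trans ?_
    rw [← Finset.mul_sum]
    refine mul_le_mul_of_nonneg_left ?_ (by positivity)
    refine le_trans ?_ (hX (N + 1))
    rw [Finset.sum_range_succ']
    exact le_add_of_nonneg_right (abs_nonneg _)
  have s2 := (orthoSeq_es hab).sum_abs_mul_le hθx hfvm (Finset.range N)
  have s3 := mul_le_mul_of_nonneg_left hB (Real.sqrt_nonneg (sqOm a b θx))
  calc _ ≤ bet a b * M * D * √(sqOm a b θx) * X
        + √(sqOm a b θx) * (M * (bet a b * X) * D) := add_le_add s1 (s2.trans s3)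
    _ = _ := by ring

end

section

variable {a b T : ℝ} {f f' f'' : ℝ → ℝ} {u0 u0x u0t Θ0 : ℝ → ℝ} {u ut ux Θ Θx : ℝ → ℝ → ℝ}

/-- If the sources of the heat equation are dominated by half of the dissipation plus a constant,
then the dissipation is bounded. -/
lemma IsWeakSol.dissipation_le (hab : a < b) (hT : 0 < T)
    (W : IsWeakSol a b T f f' u0 u0t Θ0 u ut ux Θ Θx) (R : RegT a b T u ut ux Θ Θx)
    (hΘ0 : MemL2 a b Θ0) {G : ℝ}
    (hG : ∀ᵐ t ∂volume.restrict (Ioo 0 T), ∀ N, ∑ n ∈ Finset.range N,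
      (|slc a b (ec a b (n + 1)) (fun x t => gradf f' Θ Θx x t * ut x t) t|
          * |slc a b (ec a b (n + 1)) Θ t|
        + |slc a b (es a b n) Θx t| * |slc a b (es a b n) (fun x t => f (Θ x t) * ut x t) t|)
      ≤ 2⁻¹ * sqOm a b (fun x => Θx x t) + G) :
    ∫ t in Ioo 0 T, sqOm a b (fun x => Θx x t) ≤ sqOm a b Θ0 + 2 * (T * G) := by
  have h1 : IntCyl a b T Θx := W.Θx_int
  have h2 : IntCyl a b T (fun x t => Θx x t ^ 2) := R.Θx_sq_int
  have hm := h1.ae_memL2 h2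
  have ha : IntegrableOn (fun t => sqOm a b (fun x => Θx x t)) (Ioo 0 T) := h2.integral_slice
  have hme := fun n => W.heat_mode_energy hab hT R n
  have l1 : Tendsto (fun N => ∫ t in Ioo 0 T, ∑ n ∈ Finset.range N, slc a b (es a b n) Θx t ^ 2)
      atTop (nhds (∫ t in Ioo 0 T, sqOm a b (fun x => Θx x t))) := by
    refine tendsto_integral_of_dominated_convergence (fun t => sqOm a b (fun x => Θx x t))
      (fun N => (integrable_finsetSum _ fun n _ => (hme n).1).aestronglyMeasurable) ha ?_ ?_
    · intro N
      filter_upwards [hm] with t ht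
      rw [Real.norm_eq_abs, abs_of_nonneg (Finset.sum_nonneg fun _ _ => sq_nonneg _)]
      exact (orthoSeq_es hab).bessel ht (Finset.range N)
    · filter_upwards [hm] with t ht
      have := (parseval_es hab ht ht).tendsto_sum_nat
      simpa only [slc, sqOm, sq] using this
  have hN : ∀ N, 2 * ∫ t in Ioo 0 T, ∑ n ∈ Finset.range N, slc a b (es a b n) Θx t ^ 2
      ≤ sqOm a b Θ0 + 2 * ∫ t in Ioo 0 T, (2⁻¹ * sqOm a b (fun x => Θx x t) + G) := by
    intro N
    rw [integral_finsetSum _ fun n _ => (hme n).1, Finset.mul_sum]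
    refine (Finset.sum_le_sum fun n _ => (hme n).2.2).trans ?_
    rw [Finset.sum_add_distrib, ← Finset.mul_sum,
      ← integral_finsetSum _ fun n _ => (hme n).2.1]
    refine add_le_add ((orthoSeq_ec hab).succ.bessel hΘ0 (Finset.range N))
      (mul_le_mul_of_nonneg_left ?_ zero_le_two)
    refine integral_mono_ae (integrable_finsetSum _ fun n _ => (hme n).2.1)
      ((ha.const_mul _).add (integrable_const _)) ?_
    filter_upwards [hG] with t ht
    exact ht N
  have h := le_of_tendsto' (l1.const_mul 2) hN
  rw [integral_add (ha.const_mul _) (integrable_const _), integral_const_mul, integral_const,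
    smul_eq_mul] at h
  simp only [measureReal_restrict_apply_univ, Real.volume_real_Ioo_of_le hT.le, sub_zero] at h
  linarith

lemma IsWeakSol.dissipation_bound (hab : a < b) (hT : 0 < T) (hf : HypF f f' f'') {M : ℝ}
    (hM : ∀ y ∈ Ici (0 : ℝ), |f' y| ≤ M) {A D P δ C : ℝ} (hP : P = 4 * bet a b * M * D)
    (hδ : 0 < δ) (hPδ : P * δ ≤ 2⁻¹) (hC0 : 0 ≤ C)
    (hC : ∀ g g' : ℝ → ℝ, IntegrableOn g (Ioo a b) → MemL2 a b g' →
      WeakDerivI a b g g' → ∀ N, ∑ n ∈ Finset.range N, |∫ x in Ioo a b, g x * ec a b n x|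
        ≤ C * nrmL1 a b g + δ * √(sqOm a b g'))
    (W : IsWeakSol a b T f f' u0 u0t Θ0 u ut ux Θ Θx) (R : RegT a b T u ut ux Θ Θx)
    (hΘ0 : MemL2 a b Θ0)
    (hD : ∀ t ∈ Ioo 0 T, √(sqOm a b fun x => ut x t) ≤ D)
    (hA : ∀ t ∈ Ioo 0 T, nrmL1 a b (fun x => Θ x t) ≤ A) :
    ∫ t in Ioo 0 T, sqOm a b (fun x => Θx x t)
      ≤ sqOm a b Θ0 + 2 * (T * (P / 2 * (C ^ 2 * A ^ 2 / δ))) := by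
  have h0 : IntCyl a b T Θ := W.Θ_int
  have h1 : IntCyl a b T Θx := W.Θx_int
  have hg : IntCyl a b T (gradf f' Θ Θx) := W.g1_int
  have h3 : IntCyl a b T (fun x t => f (Θ x t) * ut x t) := W.g3_int
  have hM0 : 0 ≤ M := (abs_nonneg _).trans (hM 0 (mem_Ici.2 le_rfl))
  refine W.dissipation_le hab hT R hΘ0 ?_
  filter_upwards [h0.slice, h1.ae_memL2 R.Θx_sq_int, hg.ae_memL2 (W.intCyl_gradf_sq R hM),
    h3.slice, W.Θ_W, ae_slice (p := fun x t => 0 ≤ Θ x t) W.Θ_nonneg,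
    ae_slice (p := fun x t => |gradf f' Θ Θx x t| ≤ M * |Θx x t|) (W.ae_gradf_le hM),
    ae_restrict_mem measurableSet_Ioo] with t s0 s1 s2 s3 s4 s5 s6 ht
  intro N
  have hD0 : 0 ≤ D := (Real.sqrt_nonneg _).trans (hD t ht)
  have hP0 : 0 ≤ P := by rw [hP]; have := bet_nonneg a b; positivity
  have hX := fun N => (hC _ _ s0 s1 s4 N).trans
    (add_le_add_left (mul_le_mul_of_nonneg_left (hA t ht) hC0) _)
  refine (sum_heat_source_le hab hf hM s0 s5 s1 s2 s6 (R.ut_cont.1 t (Ioo_subset_Icc_self ht))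
    (hD t ht) s3 hX N).trans ?_
  have hr := Real.sq_sqrt (sqOm_nonneg a b fun x => Θx x t)
  set r := √(sqOm a b fun x => Θx x t)
  have hy : r * (C * A) ≤ δ * r ^ 2 + C ^ 2 * A ^ 2 / δ := by
    have h4 : 0 ≤ C ^ 2 * A ^ 2 / δ := by positivity
    have h5 : (C * A) ^ 2 = δ * (C ^ 2 * A ^ 2 / δ) := by field_simp
    nlinarith [sq_nonneg (δ * r - C * A), sq_nonneg (δ * r), sq_nonneg (C * A)]
  rw [← hr]
  calc 2 * bet a b * M * D * r * (C * A + δ * r)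
      = P / 2 * (r * (C * A)) + P / 2 * (δ * r ^ 2) := by rw [hP]; ring
    _ ≤ P / 2 * (δ * r ^ 2 + C ^ 2 * A ^ 2 / δ) + P / 2 * (δ * r ^ 2) :=
        add_le_add_left (mul_le_mul_of_nonneg_left hy (by positivity)) _
    _ = (P * δ) * r ^ 2 + P / 2 * (C ^ 2 * A ^ 2 / δ) := by ring
    _ ≤ 2⁻¹ * r ^ 2 + P / 2 * (C ^ 2 * A ^ 2 / δ) :=
        add_le_add_left (mul_le_mul_of_nonneg_right hPδ (sq_nonneg _)) _

end

lemma nrmL2_eq_sqrt (a b : ℝ) (g : ℝ → ℝ) : nrmL2 a b g = √(sqOm a b g) :=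
  (Real.sqrt_eq_rpow _).symm

/-- Lemma 3.6: a priori bound for weak solutions in the class (R_T). -/
theorem statement8
    (a b : ℝ) (hab : a < b)
    (f f' f'' : ℝ → ℝ) (hf : HypF f f' f'')
    (K T : ℝ) (hK : 0 < K) (hT : 0 < T) :
    ∃ Γ > (0 : ℝ),
      ∀ u0 u0x u0t Θ0 : ℝ → ℝ, ∀ u ut ux Θ Θx : ℝ → ℝ → ℝ,
      DataI a b u0 u0x u0t Θ0 →
      nrmL2 a b u0t + (sqOm a b u0 + sqOm a b u0x) ^ (1 / 2 : ℝ) + nrmL2 a b Θ0 ≤ K →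
      IsWeakSol a b T f f' u0 u0t Θ0 u ut ux Θ Θx →
      RegT a b T u ut ux Θ Θx →
      ∀ t ∈ Ioo 0 T,
        nrmL2 a b (fun x => ut x t) + nrmL1 a b (fun x => Θ x t)
            + intOmT a b T (fun x s => (Θx x s) ^ 2) ≤ Γ := by
  obtain ⟨M, hM'⟩ := hf.bdd
  have hM : ∀ y ∈ Ici (0 : ℝ), |f' y| ≤ M := fun y hy => (hM' y hy).1
  have hM0 : 0 ≤ M := (abs_nonneg _).trans (hM 0 (mem_Ici.2 le_rfl))
  have hb := bet_nonneg a b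
  set E := 2 * K ^ 2 + 2 * (K * √(b - a)) with hE
  have hE0 : 0 < E := by positivity
  set P := 4 * bet a b * M * √E with hP
  have hP0 : 0 ≤ P := by positivity
  set δ := 1 / (2 * (P + 1)) with hδdef
  have hδ : 0 < δ := by positivity
  have hPδ : P * δ ≤ 2⁻¹ := by
    rw [hδdef, mul_one_div, div_le_iff₀ (by positivity)]
    linarith
  obtain ⟨C, hC0, hC⟩ := exists_sum_abs_ec_le hab hδ
  set G := P / 2 * (C ^ 2 * E ^ 2 / δ)
  have hG0 : 0 ≤ G := by positivity
  refine ⟨√E + E + (K ^ 2 + 2 * (T * G)), by positivity, ?_⟩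
  intro u0 u0x u0t Θ0 u ut ux Θ Θx D hdata W R t ht
  rw [nrmL2_eq_sqrt, nrmL2_eq_sqrt, ← Real.sqrt_eq_rpow] at hdata
  have n1 := Real.sqrt_nonneg (sqOm a b u0t)
  have n2 := Real.sqrt_nonneg (sqOm a b u0 + sqOm a b u0x)
  have n3 := Real.sqrt_nonneg (sqOm a b Θ0)
  have d1 : sqOm a b u0t ≤ K ^ 2 := (Real.sqrt_le_left hK.le).1 (by linarith)
  have d2 : sqOm a b u0 + sqOm a b u0x ≤ K ^ 2 := (Real.sqrt_le_left hK.le).1 (by linarith)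
  have d3 : sqOm a b Θ0 ≤ K ^ 2 := (Real.sqrt_le_left hK.le).1 (by linarith)
  have d4 : nrmL1 a b Θ0 ≤ K * √(b - a) := (D.Θ0_L2.nrmL1_le hab).trans
    (mul_le_mul_of_nonneg_right (by linarith) (Real.sqrt_nonneg _))
  have d5 := sqOm_nonneg a b u0
  have hen : ∀ s ∈ Ioo 0 T,
      sqOm a b (fun x => ut x s) + 2 * nrmL1 a b (fun x => Θ x s) ≤ E := fun s hs =>
    (W.energy hab hT hf R D hs).trans (by linarith)
  have hl1 : ∀ s, 0 ≤ nrmL1 a b fun x => Θ x s := fun s => integral_nonneg fun _ => abs_nonneg _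
  have hut : ∀ s ∈ Ioo 0 T, √(sqOm a b fun x => ut x s) ≤ √E := fun s hs =>
    Real.sqrt_le_sqrt (by linarith [hen s hs, hl1 s])
  have hΘ : ∀ s ∈ Ioo 0 T, nrmL1 a b (fun x => Θ x s) ≤ E := fun s hs => by
    linarith [hen s hs, hl1 s, sqOm_nonneg a b fun x => ut x s]
  have hdis := W.dissipation_bound hab hT hf hM hP hδ hPδ hC0 hC R D.Θ0_L2 hut hΘ
  have hsq : IntCyl a b T (fun x s => Θx x s ^ 2) := R.Θx_sq_int
  rw [nrmL2_eq_sqrt, hsq.intOmT_eq]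
  exact add_le_add (add_le_add (hut t ht) (hΘ t ht)) (hdis.trans (add_le_add_left d3 _))
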